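/- arXiv:1210.7324 — 11 statements merged into one kernel-verified Lean document; each statement's English description precedes it below -/
import Mathlib

section
/- Let E be a separable real Banach space. Then E is a GL-space if and only if for every x ∈ S_E and every ε > 0 there exists x* which is an extreme point of the unit ball B_{E*} of the dual such that x ∈ S(x*, ε) and dist(y, S(x*, ε)) + dist(y, −S(x*, ε)) < 2 + ε for all y ∈ B_E. -/
open Metric Set

/-- The slice of the closed unit ball determined by a norm-one functional `f` and `ε`:
`S(f, ε) = {x ∈ B_E : f x > 1 - ε}`. -/
def glSlice {E : Type*} [NormedAddCommGroup E] [NormedSpace ℝ E]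
    (f : E →L[ℝ] ℝ) (ε : ℝ) : Set E :=
  {x | ‖x‖ ≤ 1 ∧ 1 - ε < f x}

/-- A (real) Banach space is a generalized-lush space (GL-space) if for every `x` in the
unit sphere and every `ε > 0` there is a norm-one functional `f` with `x ∈ S(f, ε)` and
`dist(y, S(f, ε)) + dist(y, -S(f, ε)) < 2 + ε` for every `y` in the unit sphere. -/
def IsGLSpace (E : Type*) [NormedAddCommGroup E] [NormedSpace ℝ E] : Prop :=
  ∀ x : E, ‖x‖ = 1 → ∀ ε : ℝ, 0 < ε →
    ∃ f : E →L[ℝ] ℝ, ‖f‖ = 1 ∧ x ∈ glSlice f ε ∧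
      ∀ y : E, ‖y‖ = 1 →
        infDist y (glSlice f ε) + infDist y (-(glSlice f ε)) < 2 + ε

/-- An extreme point of the intersection of a decreasing sequence of slices of the dual ball is
extreme in the whole ball as soon as doubling the width of each slice keeps it inside the
previous one. -/
lemma exists_mem_extremePoints_forall_le {E : Type*} [NormedAddCommGroup E] [NormedSpace ℝ E]
    {w : ℕ → E} {δ : ℕ → ℝ} (hw : ∀ n, ‖w n‖ = 1) (hδ : ∀ n, 0 ≤ δ n)
    (h : ∀ n, ∀ g : E →L[ℝ] ℝ, ‖g‖ ≤ 1 → 1 - 2 * δ (n + 1) ≤ g (w (n + 1)) →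
      1 - δ n ≤ g (w n)) :
    ∃ f ∈ Set.extremePoints ℝ (closedBall (0 : E →L[ℝ] ℝ) 1), ∀ n, 1 - δ n ≤ f (w n) := by
  let K : ℕ → Set (WeakDual ℝ E) := fun n =>
    WeakDual.toStrongDual ⁻¹' closedBall 0 1 ∩ {f | 1 - δ n ≤ f (w n)}
  have hmem : ∀ n (f : WeakDual ℝ E),
      f ∈ K n ↔ ‖WeakDual.toStrongDual f‖ ≤ 1 ∧ 1 - δ n ≤ WeakDual.toStrongDual f (w n) :=
    fun n f => by simp [K]
  have hclosed : ∀ n, IsClosed (K n) := fun n =>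
    (WeakDual.isClosed_closedBall 0 1).inter
      (isClosed_le continuous_const (WeakDual.eval_continuous (w n)))
  have hcompact : IsCompact (K 0) :=
    (WeakDual.isCompact_closedBall 0 1).inter_right
      (isClosed_le continuous_const (WeakDual.eval_continuous (w 0)))
  have hne : (⋂ n, K n).Nonempty := by
    refine IsCompact.nonempty_iInter_of_sequence_nonempty_isCompact_isClosed K ?_ ?_ hcompact
      hclosed
    · intro n f hf
      rw [hmem] at hf ⊢
      exact ⟨hf.1, h n _ hf.1 (by linarith [hf.2, hδ (n + 1)])⟩
    · intro n
      obtain ⟨g, hg, hgw⟩ := exists_dual_vector'' ℝ (w n)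
      refine ⟨StrongDual.toWeakDual g, (hmem _ _).2 ⟨hg, ?_⟩⟩
      have : g (w n) = 1 := by simpa [hw n] using hgw
      simpa [this] using hδ n
  have hcpt : IsCompact (⋂ n, K n) :=
    hcompact.of_isClosed_subset (isClosed_iInter hclosed) (iInter_subset K 0)
  have : LocallyConvexSpace ℝ (WeakDual ℝ E) :=
    (WeakDual.withSeminorms ℝ E).toLocallyConvexSpace
  obtain ⟨f', hf'⟩ := hcpt.extremePoints_nonempty hne
  set f : E →L[ℝ] ℝ := WeakDual.toStrongDual f' with hf_def
  have hfK : ∀ n, ‖f‖ ≤ 1 ∧ 1 - δ n ≤ f (w n) := fun n =>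
    (hmem n f').1 (mem_iInter.1 hf'.1 n)
  have hmid : ∀ g : E →L[ℝ] ℝ, ‖g‖ ≤ 1 → ‖(2 : ℝ) • f - g‖ ≤ 1 → g = f := by
    have hle : ∀ (k : E →L[ℝ] ℝ) (n : ℕ), ‖k‖ ≤ 1 → k (w n) ≤ 1 := fun k n hk => by
      have := (le_abs_self _).trans (k.le_of_opNorm_le hk (w n))
      simpa [hw n] using this
    have hK : ∀ g : E →L[ℝ] ℝ, ‖g‖ ≤ 1 → ‖(2 : ℝ) • f - g‖ ≤ 1 →
        StrongDual.toWeakDual g ∈ ⋂ n, K n := by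
      intro g hg hg'
      refine mem_iInter.2 fun n => (hmem _ _).2 ⟨hg, h n g hg ?_⟩
      have h1 := hle _ (n + 1) hg'
      simp only [sub_apply, smul_apply, smul_eq_mul] at h1
      linarith [(hfK (n + 1)).2]
    intro g hg hg'
    have key : StrongDual.toWeakDual g = f' := by
      refine hf'.2 (hK g hg hg') (hK ((2 : ℝ) • f - g) hg' (by simpa using hg)) ?_
      refine ⟨1 / 2, 1 / 2, by norm_num, by norm_num, by norm_num, ?_⟩
      apply WeakDual.toStrongDual.injective
      change (1 / 2 : ℝ) • g + (1 / 2 : ℝ) • ((2 : ℝ) • f - g) = f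
      module
    rw [hf_def, ← key]
    rfl
  refine ⟨f, mem_extremePoints.2 ⟨by simpa using (hfK 0).1, ?_⟩, fun n => (hfK n).2⟩
  have heavy : ∀ g k : E →L[ℝ] ℝ, ‖g‖ ≤ 1 → ‖k‖ ≤ 1 → ∀ a b : ℝ, 0 < b → b ≤ a →
      a + b = 1 → a • g + b • k = f → g = f ∧ k = f := by
    intro g k hg hk a b hb hba hab hf
    have hgf : g = f := by
      refine hmid g hg ?_
      have : (2 : ℝ) • f - g = (2 * a - 1) • g + (2 * b) • k := by rw [← hf]; module
      rw [this]
      refine (norm_add_le _ _).trans ?_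
      rw [norm_smul, norm_smul, Real.norm_of_nonneg (by linarith),
        Real.norm_of_nonneg (by linarith)]
      nlinarith
    refine ⟨hgf, ?_⟩
    have : b • k = b • f := by
      rw [hgf] at hf
      rw [eq_sub_of_add_eq' hf, eq_sub_of_add_eq' hab]
      module
    exact smul_right_injective _ hb.ne' this
  rintro g hg k hk ⟨a, b, ha, hb, hab, hf⟩
  rw [mem_closedBall_zero_iff] at hg hk
  rcases le_total b a with hba | hba
  · exact heavy g k hg hk a b hb hba hab hf
  · exact (heavy k g hk hg b a ha hba (by linarith) (by rw [← hf, add_comm])).symm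

/-- The GL-condition at a point `y` of the unit ball, not only of the unit sphere, with explicit
points of the slice in place of distances. -/
lemma IsGLSpace.exists_approx {E : Type*} [NormedAddCommGroup E] [NormedSpace ℝ E]
    (hE : IsGLSpace E) {w : E} (hw : ‖w‖ = 1) {ε : ℝ} (hε : 0 < ε) {y : E} (hy : ‖y‖ ≤ 1) :
    ∃ f : E →L[ℝ] ℝ, ‖f‖ = 1 ∧ 1 - ε < f w ∧ ∃ z₁ ∈ glSlice f ε, ∃ z₂ ∈ glSlice f ε,
      ‖y - z₁‖ + ‖y + z₂‖ < 2 + ε := by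
  obtain ⟨f, hf, hwf, H⟩ := hE w hw ε hε
  refine ⟨f, hf, hwf.2, ?_⟩
  obtain ⟨u, hu, hyu⟩ : ∃ u : E, ‖u‖ = 1 ∧ y = ‖y‖ • u := by
    rcases eq_or_ne y 0 with rfl | hy0
    · exact ⟨w, hw, by simp⟩
    · have : ‖y‖ ≠ 0 := norm_ne_zero_iff.2 hy0
      refine ⟨‖y‖⁻¹ • y, by simp [norm_smul, this], by rw [smul_inv_smul₀ this]⟩
  have hu' := H u hu
  set d₁ := infDist u (glSlice f ε)
  set d₂ := infDist u (-glSlice f ε)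
  have hne : (glSlice f ε).Nonempty := ⟨w, hwf⟩
  obtain ⟨p, hp, hup⟩ := (infDist_lt_iff (x := u) (r := d₁ + (2 + ε - d₁ - d₂) / 2) hne).1
    (by linarith)
  obtain ⟨q, hq, huq⟩ := (infDist_lt_iff (x := u) (r := d₂ + (2 + ε - d₁ - d₂) / 2) hne.neg).1
    (by linarith)
  rw [dist_eq_norm] at hup huq
  rw [Set.mem_neg] at hq
  set a := (1 + ‖y‖) / 2 with ha
  set b := (1 - ‖y‖) / 2 with hb
  have ha0 : 0 ≤ a := by positivity
  have hb0 : 0 ≤ b := by linarith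
  have hab : a + b = 1 := by linarith
  have hyab : y = (a - b) • u := by
    rw [show a - b = ‖y‖ by linarith]; exact hyu
  have hconv : Convex ℝ (glSlice f ε) := by
    have : glSlice f ε = closedBall 0 1 ∩ {x | 1 - ε < f x} := by
      ext x; simp [glSlice]
    rw [this]
    exact (convex_closedBall 0 1).inter
      (convex_halfSpace_gt f.toLinearMap.isLinear _)
  refine ⟨a • p + b • (-q), hconv hp hq ha0 hb0 hab, a • (-q) + b • p, hconv hq hp ha0 hb0 hab, ?_⟩
  have h1 : y - (a • p + b • (-q)) = a • (u - p) - b • (u - q) := by rw [hyab]; module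
  have h2 : y + (a • (-q) + b • p) = a • (u - q) - b • (u - p) := by rw [hyab]; module
  rw [h1, h2]
  have e1 := norm_sub_le (a • (u - p)) (b • (u - q))
  have e2 := norm_sub_le (a • (u - q)) (b • (u - p))
  simp only [norm_smul, Real.norm_of_nonneg ha0, Real.norm_of_nonneg hb0] at e1 e2
  have e3 : a * ‖u - p‖ + b * ‖u - q‖ + (a * ‖u - q‖ + b * ‖u - p‖) = ‖u - p‖ + ‖u - q‖ := by
    linear_combination (‖u - p‖ + ‖u - q‖) * hab
  linarith

/-- In a GL-space, every slice given by a unit vector `w` contains a thin slice, given by another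
unit vector, all of whose functionals are large on points witnessing the GL-condition at `y`. -/
lemma IsGLSpace.exists_slice_subset {E : Type*} [NormedAddCommGroup E] [NormedSpace ℝ E]
    (hE : IsGLSpace E) {w : E} (hw : ‖w‖ = 1) {δ : ℝ} (hδ : 0 < δ) (hδ1 : δ ≤ 1) {y : E}
    (hy : ‖y‖ ≤ 1) :
    ∃ v : E, ‖v‖ = 1 ∧ ∃ z₁ z₂ : E, ‖z₁‖ ≤ 1 ∧ ‖z₂‖ ≤ 1 ∧ ‖y - z₁‖ + ‖y + z₂‖ < 2 + δ ∧
      ∀ g : E →L[ℝ] ℝ, ‖g‖ ≤ 1 → 1 - 2 * (δ / 12) ≤ g v →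
        1 - δ ≤ g w ∧ 1 - δ ≤ g z₁ ∧ 1 - δ ≤ g z₂ := by
  obtain ⟨f, hf, hfw, z₁, hz₁, z₂, hz₂, hz⟩ := hE.exists_approx hw (ε := δ / 12) (by linarith) hy
  have hle : ∀ k : E →L[ℝ] ℝ, ‖k‖ ≤ 1 → ∀ z : E, k z ≤ ‖z‖ := fun k hk z => by
    simpa using (le_abs_self _).trans (k.le_of_opNorm_le hk z)
  set s := w + z₁ + z₂ with hs
  have hs3 : 3 - 3 * (δ / 12) < ‖s‖ := by
    have := hle f hf.le s
    simp only [hs, map_add] at this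
    linarith [hz₁.2, hz₂.2]
  have hs0 : 0 < ‖s‖ := by linarith
  refine ⟨‖s‖⁻¹ • s, by simp [norm_smul, hs0.ne'], z₁, z₂, hz₁.1, hz₂.1, by linarith, ?_⟩
  intro g hg hgv
  rw [map_smul, smul_eq_mul, inv_mul_eq_div, le_div_iff₀ hs0] at hgv
  simp only [hs, map_add] at hgv
  rw [← hs] at hgv
  have hgs : 3 - 9 * (δ / 12) ≤ g w + g z₁ + g z₂ := by nlinarith
  have hw' := hle g hg w
  have h1 := hle g hg z₁
  have h2 := hle g hg z₂
  have := hz₁.1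
  have := hz₂.1
  exact ⟨by linarith, by linarith, by linarith⟩

lemma norm_eq_one_of_mem_extremePoints_closedBall {F : Type*} [NormedAddCommGroup F]
    [NormedSpace ℝ F] [Nontrivial F] {f : F}
    (hf : f ∈ Set.extremePoints ℝ (closedBall (0 : F) 1)) : ‖f‖ = 1 := by
  refine le_antisymm (by simpa using hf.1) (not_lt.1 fun hlt => ?_)
  obtain ⟨g, hg⟩ := exists_norm_eq F (sub_nonneg.2 hlt.le)
  have hfg : f + g = f := by
    refine hf.2 (x₁ := f + g) (x₂ := f - g) ?_ ?_
      ⟨1 / 2, 1 / 2, by norm_num, by norm_num, by norm_num, by module⟩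
    · rw [mem_closedBall_zero_iff]; linarith [norm_add_le f g]
    · rw [mem_closedBall_zero_iff]; linarith [norm_sub_le f g]
  rw [add_eq_left.1 hfg, norm_zero] at hg
  linarith

/-- Corollary 2.3: a separable Banach space `E` is a GL-space iff for every `x ∈ S_E` and
`ε > 0` there is an extreme point `f` of the dual unit ball with `x ∈ S(f, ε)` and
`dist(y, S(f,ε)) + dist(y, -S(f,ε)) < 2 + ε` for every `y ∈ B_E`. -/
theorem stmt_1 {E : Type*} [NormedAddCommGroup E] [NormedSpace ℝ E] [CompleteSpace E]
    [TopologicalSpace.SeparableSpace E] :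
    IsGLSpace E ↔
      ∀ x : E, ‖x‖ = 1 → ∀ ε : ℝ, 0 < ε →
        ∃ f : E →L[ℝ] ℝ, f ∈ Set.extremePoints ℝ (closedBall (0 : E →L[ℝ] ℝ) 1) ∧
          x ∈ glSlice f ε ∧
          ∀ y : E, ‖y‖ ≤ 1 →
            infDist y (glSlice f ε) + infDist y (-(glSlice f ε)) < 2 + ε := by
  constructor
  · intro hE x hx ε hε
    set η := min (ε / 4) 1 with hη
    have hη0 : 0 < η := by positivity
    have hηε : η ≤ ε / 4 := min_le_left _ _
    have hη1 : η ≤ 1 := min_le_right _ _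
    have : Nonempty (closedBall (0 : E) 1) := ⟨⟨0, by simp⟩⟩
    have : SecondCountableTopology E := UniformSpace.secondCountable_of_separable E
    let y := TopologicalSpace.denseSeq (closedBall (0 : E) 1)
    let δ : ℕ → ℝ := fun n => η / 12 ^ n
    have hδ0 : ∀ n, 0 < δ n := fun n => by positivity
    have hδη : ∀ n, δ n ≤ η := fun n => div_le_self hη0.le (one_le_pow₀ (by norm_num))
    have hstep : ∀ (n : ℕ) (w : sphere (0 : E) 1), ∃ v : sphere (0 : E) 1, ∃ z₁ z₂ : E,
        ‖z₁‖ ≤ 1 ∧ ‖z₂‖ ≤ 1 ∧ ‖(y n : E) - z₁‖ + ‖(y n : E) + z₂‖ < 2 + δ n ∧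
        ∀ g : E →L[ℝ] ℝ, ‖g‖ ≤ 1 → 1 - 2 * δ (n + 1) ≤ g v →
          1 - δ n ≤ g w ∧ 1 - δ n ≤ g z₁ ∧ 1 - δ n ≤ g z₂ := by
      intro n w
      obtain ⟨v, hv, h⟩ := hE.exists_slice_subset (norm_eq_of_mem_sphere w) (hδ0 n)
        ((hδη n).trans hη1) (mem_closedBall_zero_iff.1 (y n).2)
      have hδs : δ (n + 1) = δ n / 12 := by simp only [δ, pow_succ]; field_simp
      rw [hδs]
      exact ⟨⟨v, by simpa using hv⟩, h⟩
    choose V z₁ z₂ hz₁ hz₂ hz hV using hstep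
    have hxs : x ∈ sphere (0 : E) 1 := by simpa using hx
    let w : ℕ → sphere (0 : E) 1 := fun n => Nat.rec (motive := fun _ => sphere (0 : E) 1)
      ⟨x, hxs⟩ V n
    have hw : ∀ n, ∀ g : E →L[ℝ] ℝ, ‖g‖ ≤ 1 → 1 - 2 * δ (n + 1) ≤ g (w (n + 1) : E) →
        1 - δ n ≤ g (w n : E) := by
      intro n g hg hgw
      exact (hV n (w n) g hg hgw).1
    obtain ⟨f, hfext, hf⟩ := exists_mem_extremePoints_forall_le (w := fun n => (w n : E))
      (fun n => norm_eq_of_mem_sphere (w n)) (fun n => (hδ0 n).le) hw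
    have hf1 : ‖f‖ ≤ 1 := by simpa using hfext.1
    refine ⟨f, hfext, ⟨hx.le, ?_⟩, fun u hu => ?_⟩
    · have h0 : 1 - δ 0 ≤ f x := hf 0
      linarith [hδη 0]
    · obtain ⟨n, hn⟩ := (TopologicalSpace.denseRange_denseSeq (closedBall (0 : E) 1)).exists_dist_lt
        ⟨u, by simpa using hu⟩ hη0
      have hn : dist u (y n) < η := hn
      obtain ⟨-, h1, h2⟩ := hV n (w n) f hf1 (by
        have : 1 - δ (n + 1) ≤ f (V n (w n)) := hf (n + 1)
        linarith [hδ0 (n + 1)])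
      have hm1 : z₁ n (w n) ∈ glSlice f ε := ⟨hz₁ _ _, by linarith [hδη n]⟩
      have hm2 : -z₂ n (w n) ∈ -glSlice f ε := by
        rw [Set.neg_mem_neg]
        exact ⟨hz₂ _ _, by linarith [hδη n]⟩
      have d1 := (infDist_le_dist_of_mem hm1).trans (dist_triangle u (y n) _)
      have d2 := (infDist_le_dist_of_mem hm2).trans (dist_triangle u (y n) _)
      have hz' := hz n (w n)
      rw [dist_eq_norm (y n : E)] at d1 d2
      rw [sub_neg_eq_add] at d2
      linarith [hδη n]
  · intro H x hx ε hε
    obtain ⟨f, hf, hxf, h⟩ := H x hx ε hε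
    have hx0 : ‖x‖ ≠ 0 := by simp [hx]
    obtain ⟨g, hg, -⟩ := exists_dual_vector ℝ x hx0
    have : Nontrivial (E →L[ℝ] ℝ) := ⟨g, 0, by rintro rfl; simp at hg⟩
    exact ⟨f, norm_eq_one_of_mem_extremePoints_closedBall hf, hxf, fun y hy => h y hy.le⟩
end

section
/- Every real almost-CL-space is a GL-space. -/
open Metric Set

/-- Every point of the unit sphere lies in a maximal convex subset of the sphere. -/
theorem exists_maximal_convex_subset_sphere {E : Type*} [NormedAddCommGroup E] [NormedSpace ℝ E]
    {x : E} (hx : ‖x‖ = 1) :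
    ∃ C : Set E, x ∈ C ∧ C ⊆ sphere (0 : E) 1 ∧ Convex ℝ C ∧
      ∀ D : Set E, D ⊆ sphere (0 : E) 1 → Convex ℝ D → C ⊆ D → D = C := by
  obtain ⟨C, hxC, hC⟩ := zorn_subset_nonempty {C : Set E | C ⊆ sphere (0 : E) 1 ∧ Convex ℝ C}
    (fun c hc hchain _ => ⟨⋃₀ c, ⟨sUnion_subset fun s hs => (hc hs).1,
      hchain.directedOn.convex_sUnion fun s hs => (hc hs).2⟩,
      fun s hs => subset_sUnion_of_mem hs⟩)
    {x} ⟨by simpa using hx, convex_singleton x⟩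
  exact ⟨C, hxC rfl, hC.prop.1, hC.prop.2,
    fun D hD hDc hCD => (hC.eq_of_subset ⟨hD, hDc⟩ hCD).symm⟩

/-- A nonempty convex subset of the unit sphere lies in the set where some norm-one functional
equals one. -/
theorem exists_norm_one_eq_one_on_convex {E : Type*} [NormedAddCommGroup E] [NormedSpace ℝ E]
    {C : Set E} (hne : C.Nonempty) (hC : C ⊆ sphere (0 : E) 1) (hconv : Convex ℝ C) :
    ∃ f : E →L[ℝ] ℝ, ‖f‖ = 1 ∧ ∀ c ∈ C, f c = 1 := by
  have hdisj : Disjoint (ball (0 : E) 1) C :=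
    sphere_disjoint_ball.symm.mono_right hC
  obtain ⟨f, u, hfu, huf⟩ := geometric_hahn_banach_open (convex_ball (0 : E) 1) isOpen_ball
    hconv hdisj
  have hu : 0 < u := by simpa using hfu 0 (by simp)
  have hle : ∀ y, f y ≤ u * ‖y‖ := by
    intro y
    by_contra! h
    have hpos : 0 < f y := lt_of_le_of_lt (by positivity) h
    have hmem : (u / f y) • y ∈ ball (0 : E) 1 := by
      rw [mem_ball_zero_iff, norm_smul, Real.norm_of_nonneg (by positivity), div_mul_eq_mul_div,
        div_lt_one hpos]
      exact h
    have := hfu _ hmem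
    rw [map_smul, smul_eq_mul, div_mul_cancel₀ _ hpos.ne'] at this
    exact lt_irrefl _ this
  have hC1 : ∀ c ∈ C, ‖c‖ = 1 := fun c hc => by simpa using hC hc
  have hval : ∀ c ∈ C, (u⁻¹ • f) c = 1 := by
    intro c hc
    have h : f c = u := le_antisymm (by simpa [hC1 c hc] using hle c) (huf c hc)
    simp [h, hu.ne']
  refine ⟨u⁻¹ • f, le_antisymm ?_ ?_, hval⟩
  · refine ContinuousLinearMap.opNorm_le_bound _ zero_le_one fun y => ?_
    have h1 := hle y
    have h2 := hle (-y)
    rw [map_neg, norm_neg] at h2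
    have h3 : |f y| ≤ u * ‖y‖ := abs_le.2 ⟨by linarith, h1⟩
    rw [smul_apply, norm_smul, Real.norm_of_nonneg (by positivity),
      Real.norm_eq_abs, one_mul, inv_mul_le_iff₀ hu]
    exact h3
  · obtain ⟨c, hc⟩ := hne
    have := (u⁻¹ • f).le_opNorm c
    rwa [hval c hc, hC1 c hc, norm_one, mul_one] at this

/-- A point of the convex hull of `C ∪ -C`, with `C` a convex subset of the unit sphere, has
distances at most two in total to some point of `C` and some point of `-C`. -/
theorem exists_dist_add_dist_le_two {E : Type*} [NormedAddCommGroup E] [NormedSpace ℝ E]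
    {C : Set E} (hne : C.Nonempty) (hC : C ⊆ sphere (0 : E) 1) (hconv : Convex ℝ C)
    {z : E} (hz : z ∈ convexHull ℝ (C ∪ -C)) :
    ∃ c ∈ C, ∃ d ∈ -C, dist z c + dist z d ≤ 2 := by
  rw [convexHull_union hne hne.neg, hconv.convexHull_eq, hconv.neg.convexHull_eq,
    mem_convexJoin] at hz
  obtain ⟨c, hc, d, hd, hz⟩ := hz
  refine ⟨c, hc, d, hd, ?_⟩
  have hc1 : ‖c‖ = 1 := by simpa using hC hc
  have hd1 : ‖d‖ = 1 := by simpa using hC hd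
  rw [dist_comm z c, dist_add_dist_of_mem_segment hz, dist_eq_norm]
  linarith [norm_sub_le c d]

/-- Example 2.4: every almost-CL-space is a GL-space.  `E` is an almost-CL-space when for
every maximal convex subset `C` of the unit sphere, `B_E = closure (co (C ∪ -C))`. -/
theorem stmt_2 {E : Type*} [NormedAddCommGroup E] [NormedSpace ℝ E] [CompleteSpace E]
    (hACL : ∀ C : Set E, C ⊆ sphere (0 : E) 1 → Convex ℝ C →
      (∀ D : Set E, D ⊆ sphere (0 : E) 1 → Convex ℝ D → C ⊆ D → D = C) →
      closedBall (0 : E) 1 = closure (convexHull ℝ (C ∪ -C))) :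
    IsGLSpace E := by
  intro x hx ε hε
  obtain ⟨C, hxC, hC, hconv, hmax⟩ := exists_maximal_convex_subset_sphere hx
  obtain ⟨f, hf, hfC⟩ := exists_norm_one_eq_one_on_convex ⟨x, hxC⟩ hC hconv
  have hsub : C ⊆ glSlice f ε := fun c hc =>
    ⟨(mem_sphere_zero_iff_norm.1 (hC hc)).le, by rw [hfC c hc]; linarith⟩
  refine ⟨f, hf, hsub hxC, fun y hy => ?_⟩
  have hycl : y ∈ closure (convexHull ℝ (C ∪ -C)) := by
    rw [← hACL C hC hconv hmax]
    simp [hy]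
  obtain ⟨z, hz, hyz⟩ := Metric.mem_closure_iff.1 hycl (ε / 2) (half_pos hε)
  obtain ⟨c, hc, d, hd, hcd⟩ := exists_dist_add_dist_le_two ⟨x, hxC⟩ hC hconv hz
  have h1 : infDist y (glSlice f ε) ≤ dist y c := infDist_le_dist_of_mem (hsub hc)
  have h2 : infDist y (-(glSlice f ε)) ≤ dist y d :=
    infDist_le_dist_of_mem (neg_subset_neg.2 hsub hd)
  linarith [dist_triangle y z c, dist_triangle y z d]
end

section
/- Every separable real lush space is a GL-space. -/
open Metric Set

/-- A (real) Banach space is lush if for all `x, y` in the unit sphere and `ε > 0` there is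
a norm-one functional `f` with `x ∈ S(f, ε)` and `dist(y, aco S(f, ε)) < ε`, where in the
real case `aco S = co (S ∪ -S)`. -/
def IsLush (E : Type*) [NormedAddCommGroup E] [NormedSpace ℝ E] : Prop :=
  ∀ x y : E, ‖x‖ = 1 → ‖y‖ = 1 → ∀ ε : ℝ, 0 < ε →
    ∃ f : E →L[ℝ] ℝ, ‖f‖ = 1 ∧ x ∈ glSlice f ε ∧
      infDist y (convexHull ℝ (glSlice f ε ∪ -(glSlice f ε))) < ε

/-- A slice is convex. -/
theorem convex_glSlice {E : Type*} [NormedAddCommGroup E] [NormedSpace ℝ E]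
    (f : E →L[ℝ] ℝ) (ε : ℝ) : Convex ℝ (glSlice f ε) := by
  have h : glSlice f ε = closedBall (0 : E) 1 ∩ f ⁻¹' Ioi (1 - ε) := by
    ext x
    simp [glSlice]
  rw [h]
  exact (convex_closedBall _ _).inter ((convex_Ioi _).linear_preimage f.toLinearMap)

/-- In a lush space, `y` is nearly a combination `t • a - s • b` of points `a, b` of the unit ball
such that every functional that almost norms a suitable unit vector `x'` is almost `1` at each of
`x`, `a`, `b`. -/
theorem IsLush.exists_unit_vector {E : Type*} [NormedAddCommGroup E] [NormedSpace ℝ E]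
    (hE : IsLush E) {x y : E} (hx : ‖x‖ = 1) (hy : ‖y‖ = 1) {η : ℝ} (hη : 0 < η) (hη1 : η < 1) :
    ∃ x' : E, ‖x'‖ = 1 ∧ ∃ (a b : E) (t s : ℝ), ‖a‖ ≤ 1 ∧ ‖b‖ ≤ 1 ∧ 0 ≤ t ∧ 0 ≤ s ∧ t + s = 1 ∧
      dist y (t • a - s • b) < η ∧
      ∀ g : E →L[ℝ] ℝ, ‖g‖ ≤ 1 → ∀ δ : ℝ, 0 ≤ δ → 1 - δ ≤ g x' →
        1 - 3 * η - 3 * δ ≤ g x ∧ 1 - 3 * η - 3 * δ ≤ g a ∧ 1 - 3 * η - 3 * δ ≤ g b := by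
  obtain ⟨f, hf, hxf, hd⟩ := hE x y hx hy η hη
  have hne : (glSlice f η).Nonempty := ⟨x, hxf⟩
  have hne' : (convexHull ℝ (glSlice f η ∪ -glSlice f η)).Nonempty :=
    (hne.mono subset_union_left).convexHull
  obtain ⟨z, hz, hyz⟩ := (infDist_lt_iff hne').1 hd
  rw [convexHull_union hne hne.neg, (convex_glSlice f η).convexHull_eq,
    (convex_glSlice f η).neg.convexHull_eq, mem_convexJoin] at hz
  obtain ⟨a, ha, b, hb, t, s, ht, hs, hts, rfl⟩ := hz
  rw [Set.mem_neg] at hb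
  have bound : ∀ g : E →L[ℝ] ℝ, ‖g‖ ≤ 1 → ∀ v : E, ‖v‖ ≤ 1 → g v ≤ 1 := fun g hg v hv =>
    (le_abs_self _).trans (g.le_of_opNorm_le_of_le hg hv |>.trans (by norm_num))
  have hNlow : 3 - 3 * η ≤ ‖x + a + -b‖ := by
    have h1 : f (x + a + -b) ≤ ‖x + a + -b‖ := by
      have h := (le_abs_self _).trans (f.le_opNorm (x + a + -b))
      rwa [hf, one_mul] at h
    have h2 : f (x + a + -b) = f x + f a + f (-b) := by rw [map_add, map_add]
    linarith [hxf.2, ha.2, hb.2]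
  have hNup : ‖x + a + -b‖ ≤ 3 := by
    have := norm_add₃_le (a := x) (b := a) (c := -b)
    linarith [ha.1, hb.1]
  have hNpos : 0 < ‖x + a + -b‖ := by linarith
  refine ⟨‖x + a + -b‖⁻¹ • (x + a + -b), ?_, a, -b, t, s, ha.1, hb.1, ht, hs, hts, ?_, ?_⟩
  · rw [norm_smul, norm_inv, norm_norm, inv_mul_cancel₀ hNpos.ne']
  · simpa using hyz
  · intro g hg δ hδ hgx
    rw [map_smul, smul_eq_mul, le_inv_mul_iff₀ hNpos, map_add, map_add] at hgx
    have h1 := bound g hg x hx.le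
    have h2 := bound g hg a ha.1
    have h3 := bound g hg (-b) hb.1
    have h4 : ‖x + a + -b‖ * δ ≤ 3 * δ := by gcongr
    refine ⟨?_, ?_, ?_⟩ <;> linarith

/-- If almost norming `x (n + 1)` forces a functional to almost norm `x n`, with errors tending to `0`,
then a single norm-one functional almost norms every `x n`. -/
theorem exists_norm_one_of_nested {E : Type*} [NormedAddCommGroup E] [NormedSpace ℝ E]
    {x : ℕ → E} {δ : ℕ → ℝ} (hx : ∀ n, ‖x n‖ = 1) (hδ : ∀ n, 0 ≤ δ n)
    (hlim : Filter.Tendsto δ Filter.atTop (nhds 0))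
    (hnest : ∀ n, ∀ g : E →L[ℝ] ℝ, ‖g‖ ≤ 1 → 1 - δ (n + 1) ≤ g (x (n + 1)) → 1 - δ n ≤ g (x n)) :
    ∃ f : E →L[ℝ] ℝ, ‖f‖ = 1 ∧ ∀ n, 1 - δ n ≤ f (x n) := by
  let B : Set (WeakDual ℝ E) :=
    WeakDual.toStrongDual ⁻¹' closedBall (0 : StrongDual ℝ E) 1
  have hB : IsCompact B := WeakDual.isCompact_closedBall 0 1
  let K : ℕ → Set (WeakDual ℝ E) := fun n => B ∩ {g | 1 - δ n ≤ g (x n)}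
  have hclosed : ∀ n, IsClosed {g : WeakDual ℝ E | 1 - δ n ≤ g (x n)} := fun n =>
    isClosed_le continuous_const (WeakDual.eval_continuous (x n))
  obtain ⟨f, hf⟩ := IsCompact.nonempty_iInter_of_sequence_nonempty_isCompact_isClosed K
    (fun n g hg => ⟨hg.1, hnest n (WeakDual.toStrongDual g) (by simpa [B] using hg.1) hg.2⟩)
    (fun n => by
      obtain ⟨g, hg, hgx⟩ := exists_dual_vector ℝ (x n) (norm_ne_zero_iff.1 (by simp [hx n]))
      refine ⟨StrongDual.toWeakDual g, by simp [B, hg], ?_⟩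
      change 1 - δ n ≤ g (x n)
      rw [hgx, hx n]
      simpa using hδ n)
    (hB.inter_right (hclosed 0)) (fun n => hB.isClosed.inter (hclosed n))
  rw [mem_iInter] at hf
  have hf1 : ‖WeakDual.toStrongDual f‖ ≤ 1 := by simpa [B] using (hf 0).1
  refine ⟨WeakDual.toStrongDual f, le_antisymm hf1 ?_, fun n => (hf n).2⟩
  have h1 : ∀ n, 1 - δ n ≤ ‖WeakDual.toStrongDual f‖ := fun n => by
    have h := (le_abs_self _).trans ((WeakDual.toStrongDual f).le_opNorm (x n))
    rw [hx n, mul_one] at h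
    exact (hf n).2.trans h
  have h2 := hlim.const_sub 1
  rw [sub_zero] at h2
  exact le_of_tendsto' h2 h1

/-- The sum of the distances from `y` to `S` and to `-S` is controlled by the distance from `y` to
a point of the absolutely convex hull of `S`. -/
theorem infDist_add_infDist_neg_le {E : Type*} [NormedAddCommGroup E] [NormedSpace ℝ E]
    {S : Set E} {y a b : E} {t s : ℝ} (ha : a ∈ S) (hb : b ∈ S) (ha1 : ‖a‖ ≤ 1) (hb1 : ‖b‖ ≤ 1)
    (ht : 0 ≤ t) (hs : 0 ≤ s) (hts : t + s = 1) :
    infDist y S + infDist y (-S) ≤ 2 + 2 * dist y (t • a - s • b) := by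
  have hab : ‖a + b‖ ≤ 2 := (norm_add_le a b).trans (by linarith)
  have h1 : infDist y S ≤ dist y (t • a - s • b) + s * 2 := by
    refine (infDist_le_dist_of_mem ha).trans ((dist_triangle _ (t • a - s • b) _).trans ?_)
    have : t • a - s • b - a = (-s) • (a + b) := by
      rw [← eq_sub_iff_add_eq] at hts
      subst hts
      module
    rw [dist_eq_norm (t • a - s • b), this, norm_smul, norm_neg, Real.norm_of_nonneg hs]
    gcongr
  have h2 : infDist y (-S) ≤ dist y (t • a - s • b) + t * 2 := by
    have hb' : -b ∈ -S := by simpa using hb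
    refine (infDist_le_dist_of_mem hb').trans ((dist_triangle _ (t • a - s • b) _).trans ?_)
    have : t • a - s • b - -b = t • (a + b) := by
      rw [← eq_sub_iff_add_eq] at hts
      subst hts
      module
    rw [dist_eq_norm (t • a - s • b), this, norm_smul, Real.norm_of_nonneg ht]
    gcongr
  linarith

/-- Example 2.5: every separable lush space is a GL-space. -/
theorem stmt_3 {E : Type*} [NormedAddCommGroup E] [NormedSpace ℝ E] [CompleteSpace E]
    [TopologicalSpace.SeparableSpace E] (hE : IsLush E) :
    IsGLSpace E := by
  intro x₀ hx₀ ε hε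
  have : SecondCountableTopology E := UniformSpace.secondCountable_of_separable E
  have : Nonempty (sphere (0 : E) 1) := ⟨⟨x₀, by simpa using hx₀⟩⟩
  obtain ⟨y, hy⟩ := TopologicalSpace.exists_dense_seq (sphere (0 : E) 1)
  obtain ⟨c, hc, hc1, hcε⟩ : ∃ c : ℝ, 0 < c ∧ c < 1 ∧ 5 * c < ε :=
    ⟨min ε 1 / 10, by positivity, by linarith [min_le_right ε 1], by
      linarith [min_le_left ε 1, lt_min hε one_pos]⟩
  let η : ℕ → ℝ := fun n => c * (1 / 9) ^ n
  have hη : ∀ n, 0 < η n := fun n => by positivity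
  have hηc : ∀ n, η n ≤ c := fun n =>
    mul_le_of_le_one_right hc.le (pow_le_one₀ (by norm_num) (by norm_num))
  have hη_succ : ∀ n, η (n + 1) = η n / 9 := fun n => by
    simp only [η, pow_succ]; ring
  have step := fun (n : ℕ) (x : {x : E // ‖x‖ = 1}) =>
    hE.exists_unit_vector x.2 (mem_sphere_zero_iff_norm.1 (y n).2) (hη n)
      ((hηc n).trans_lt hc1)
  choose F hF a b t s ha hb ht hs hts hd hg using step
  let X : ℕ → {x : E // ‖x‖ = 1} := fun n =>
    Nat.rec ⟨x₀, hx₀⟩ (fun n x => ⟨F n x, hF n x⟩) n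
  have key : ∀ n, ∀ g : E →L[ℝ] ℝ, ‖g‖ ≤ 1 → 1 - 5 * η (n + 1) ≤ g (X (n + 1)).1 →
      1 - 5 * η n ≤ g (X n).1 ∧ 1 - 5 * η n ≤ g (a n (X n)) ∧ 1 - 5 * η n ≤ g (b n (X n)) := by
    intro n g hg1 hgx
    obtain ⟨h1, h2, h3⟩ := hg n (X n) g hg1 _ (by linarith [hη (n + 1)]) hgx
    rw [hη_succ] at h1 h2 h3
    have := hη n
    refine ⟨?_, ?_, ?_⟩ <;> linarith
  have hlim : Filter.Tendsto (fun n => 5 * η n) Filter.atTop (nhds 0) := by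
    have h := ((tendsto_pow_atTop_nhds_zero_of_lt_one (r := (1 / 9 : ℝ)) (by norm_num)
      (by norm_num)).const_mul c).const_mul 5
    simpa only [mul_zero] using h
  obtain ⟨f, hf, hfX⟩ := exists_norm_one_of_nested (x := fun n => (X n).1)
    (δ := fun n => 5 * η n) (fun n => (X n).2) (fun n => by linarith [hη n]) hlim (fun n g h1 h2 => (key n g h1 h2).1)
  refine ⟨f, hf, ⟨hx₀.le, ?_⟩, fun z hz => ?_⟩
  · have : 1 - 5 * η 0 ≤ f x₀ := hfX 0
    linarith [hηc 0]
  · obtain ⟨n, hn⟩ := hy.exists_dist_lt ⟨z, by simpa using hz⟩ hc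
    have hn' : dist z (y n) < c := hn
    obtain ⟨-, h2, h3⟩ := key n f hf.le (hfX (n + 1))
    have hsum := infDist_add_infDist_neg_le (S := glSlice f ε) (y := z)
      (a := a n (X n)) (b := b n (X n)) ⟨ha n (X n), by linarith [hηc n]⟩
      ⟨hb n (X n), by linarith [hηc n]⟩ (ha n (X n)) (hb n (X n)) (ht n (X n)) (hs n (X n))
      (hts n (X n))
    have htri := dist_triangle z (y n) (t n (X n) • a n (X n) - s n (X n) • b n (X n))
    linarith [hd n (X n), hηc n]
end

section
/- Let K be a compact Hausdorff space and let X be a C-rich closed subspace of the real space C(K). If X is separable, then X (with the norm induced from C(K)) is a GL-space. -/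
open Metric Set

open ContinuousMap in
/-- `X` is a C-rich closed subspace of `C(K)`: for every nonempty open `U ⊆ K` and `ε > 0`
there is a nonnegative norm-one `h ∈ C(K)` supported in `U` with `dist(h, X) < ε`. -/
def IsCRich {K : Type*} [TopologicalSpace K] [CompactSpace K]
    (X : Subspace ℝ C(K, ℝ)) : Prop :=
  IsClosed (X : Set C(K, ℝ)) ∧
    ∀ U : Set K, IsOpen U → U.Nonempty → ∀ ε : ℝ, 0 < ε →
      ∃ h : C(K, ℝ), (∀ t, 0 ≤ h t) ∧ ‖h‖ = 1 ∧ tsupport ⇑h ⊆ U ∧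
        infDist h (X : Set C(K, ℝ)) < ε

/-- A bump near `t`: some `h` with values in `[0, 1]`, within `δ` of `X`, satisfies
`1 - δ < h t` and lives where `y` is within `δ` of `y t`. -/
def HasBump {K : Type*} [TopologicalSpace K] [CompactSpace K]
    (X : Subspace ℝ C(K, ℝ)) (y : C(K, ℝ)) (δ : ℝ) (t : K) : Prop :=
  ∃ h g : C(K, ℝ), (∀ s, 0 ≤ h s) ∧ (∀ s, h s ≤ 1) ∧ g ∈ X ∧ ‖g - h‖ < δ ∧
    1 - δ < h t ∧ ∀ s, h s ≠ 0 → |y s - y t| < δ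

/-- Absolute values of a real continuous function are bounded by its norm. -/
lemma abs_apply_le_norm {K : Type*} [TopologicalSpace K] [CompactSpace K]
    (y : C(K, ℝ)) (s : K) : |y s| ≤ ‖y‖ := by
  simpa using y.norm_coe_le_norm s

lemma dense_interior_hasBump {K : Type*} [TopologicalSpace K] [CompactSpace K]
    {X : Subspace ℝ C(K, ℝ)} (hX : IsCRich X) (y : C(K, ℝ)) {δ : ℝ} (hδ : 0 < δ) :
    Dense (interior {t | HasBump X y δ t}) := by
  rw [dense_iff_inter_open]
  rintro V hV ⟨v, hv⟩
  have hyV : IsOpen {s | |y s - y v| < δ / 2} :=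
    isOpen_lt (by fun_prop) continuous_const
  obtain ⟨h, h0, h1, hsupp, hdist⟩ := hX.2 (V ∩ {s | |y s - y v| < δ / 2})
    (hV.inter hyV) ⟨v, hv, by simpa using half_pos hδ⟩ δ hδ
  obtain ⟨g, hg, hgd⟩ := (infDist_lt_iff ⟨0, X.zero_mem⟩).1 hdist
  have hle : ∀ s, h s ≤ 1 := fun s => (le_abs_self _).trans (h1 ▸ abs_apply_le_norm h s)
  have hsub : ∀ s, h s ≠ 0 → s ∈ V ∧ |y s - y v| < δ / 2 := fun s hs =>
    hsupp (subset_tsupport _ hs)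
  have hpeak : ∃ s, max 0 (1 - δ) < h s := by
    by_contra! hcon
    have : ‖h‖ ≤ max 0 (1 - δ) :=
      (ContinuousMap.norm_le _ (le_max_left _ _)).2 fun s => by
        rw [Real.norm_eq_abs, abs_of_nonneg (h0 s)]; exact hcon s
    rw [h1] at this
    exact absurd this (not_le.2 (max_lt one_pos (by linarith)))
  obtain ⟨s, hs⟩ := hpeak
  have hW : {t | max 0 (1 - δ) < h t} ⊆ {t | HasBump X y δ t} := by
    intro t ht
    have ht' : 0 < h t ∧ 1 - δ < h t := max_lt_iff.1 ht
    refine ⟨h, g, h0, hle, hg, ?_, ht'.2, fun r hr => ?_⟩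
    · rwa [← dist_eq_norm, dist_comm]
    · have h2 := abs_lt.1 (hsub r hr).2
      have h3 := abs_lt.1 (hsub t ht'.1.ne').2
      rw [abs_lt]; constructor <;> linarith
  exact ⟨s, (hsub s (max_lt_iff.1 hs).1.ne').1,
    interior_maximal hW (isOpen_lt continuous_const h.continuous) hs⟩

/-- By Baire's theorem, every nonempty open set contains a point with bumps for all of `X`. -/
lemma exists_forall_hasBump {K : Type*} [TopologicalSpace K] [CompactSpace K] [T2Space K]
    {X : Subspace ℝ C(K, ℝ)} (hX : IsCRich X) [TopologicalSpace.SeparableSpace X]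
    {U : Set K} (hU : IsOpen U) (hne : U.Nonempty) :
    ∃ t ∈ U, ∀ y ∈ X, ∀ δ > 0, HasBump X y δ t := by
  have hdense : Dense (⋂ p : ℕ × ℕ, interior
      {t | HasBump X (TopologicalSpace.denseSeq X p.1 : C(K, ℝ)) (1 / (p.2 + 1 : ℝ)) t}) :=
    dense_iInter_of_isOpen (fun _ => isOpen_interior)
      fun _ => dense_interior_hasBump hX _ Nat.one_div_pos_of_nat
  obtain ⟨t, htU, ht⟩ := hdense.inter_open_nonempty U hU hne
  refine ⟨t, htU, fun y hy δ hδ => ?_⟩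
  obtain ⟨n, hn⟩ := exists_nat_one_div_lt (show 0 < δ / 3 by positivity)
  obtain ⟨k, hk⟩ := (TopologicalSpace.denseRange_denseSeq X).exists_dist_lt ⟨y, hy⟩
    (show 0 < δ / 3 by positivity)
  obtain ⟨h, g, h0, hle, hg, hgh, ht1, hsupp⟩ := interior_subset (mem_iInter.1 ht (k, n))
  refine ⟨h, g, h0, hle, hg, by linarith, by linarith, fun s hs => ?_⟩
  have hk' : ‖y - (TopologicalSpace.denseSeq X k : C(K, ℝ))‖ < δ / 3 := by
    simpa [dist_eq_norm, Subtype.dist_eq] using hk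
  have h1 := abs_lt.1 (hsupp s hs)
  have h2 := abs_lt.1 ((abs_apply_le_norm _ s).trans_lt hk')
  have h3 := abs_lt.1 ((abs_apply_le_norm _ t).trans_lt hk')
  simp only [ContinuousMap.sub_apply] at h1 h2 h3
  rw [abs_lt]; constructor <;> linarith

lemma exists_near_peak {K : Type*} [TopologicalSpace K] [CompactSpace K]
    {X : Subspace ℝ C(K, ℝ)} {y : C(K, ℝ)} (hy : y ∈ X) (hy1 : ‖y‖ ≤ 1) {δ : ℝ}
    {t : K} (ht : HasBump X y δ t) :
    ∃ z ∈ X, ‖z‖ ≤ 1 ∧ 1 - 7 * δ ≤ z t ∧ ‖y - z‖ ≤ 1 - y t + 5 * δ := by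
  obtain ⟨h, g, h0, hle, hg, hgh, ht1, hsupp⟩ := ht
  have hδ : 0 < δ := (norm_nonneg _).trans_lt hgh
  have hyb : ∀ s, -1 ≤ y s ∧ y s ≤ 1 := fun s => abs_le.1 ((abs_apply_le_norm y s).trans hy1)
  have hgb : ∀ s, -δ < g s - h s ∧ g s - h s < δ := fun s =>
    abs_lt.1 ((abs_apply_le_norm (g - h) s).trans_lt hgh)
  set c := y t
  obtain ⟨hc1, hc2⟩ := hyb t
  set w : C(K, ℝ) := y + (1 - c) • g
  have hws : ∀ s, w s = y s + (1 - c) * g s := fun s => rfl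
  have hwn : ‖w‖ ≤ 1 + 3 * δ := by
    refine (ContinuousMap.norm_le _ (by positivity)).2 fun s => ?_
    rw [Real.norm_eq_abs, abs_le, hws]
    obtain ⟨ha, hb⟩ := hyb s
    obtain ⟨hd, he⟩ := hgb s
    have e1 : (1 - c) * (g s - h s) ≤ 2 * δ := by nlinarith
    have e2 : -(2 * δ) ≤ (1 - c) * (g s - h s) := by nlinarith
    have e3 : 0 ≤ (1 - c) * h s := mul_nonneg (by linarith) (h0 s)
    refine ⟨by linarith, ?_⟩
    rcases eq_or_ne (h s) 0 with hs | hs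
    · rw [hs] at e1; linarith
    · have := abs_lt.1 (hsupp s hs)
      have e4 : (1 - c) * h s ≤ 1 - c := mul_le_of_le_one_right (by linarith) (hle s)
      linarith
  have hwt : 1 - 4 * δ ≤ w t := by
    rw [hws]
    obtain ⟨hd, he⟩ := hgb t
    nlinarith
  have hyw : ‖y - w‖ ≤ 1 - c + 2 * δ := by
    refine (ContinuousMap.norm_le _ (by linarith)).2 fun s => ?_
    obtain ⟨hd, he⟩ := hgb s
    have e0 := h0 s
    have e1 := hle s
    rw [ContinuousMap.sub_apply, hws, Real.norm_eq_abs, abs_le]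
    constructor <;> nlinarith
  set r : ℝ := 1 + 3 * δ with hr
  have hr0 : 0 < r := by positivity
  have hwz : ‖w - r⁻¹ • w‖ ≤ 3 * δ := by
    have hri : r⁻¹ ≤ 1 := inv_le_one_of_one_le₀ (by linarith)
    have : w - r⁻¹ • w = (1 - r⁻¹) • w := by rw [sub_smul, one_smul]
    rw [this, norm_smul, Real.norm_eq_abs, abs_of_nonneg (by linarith)]
    calc (1 - r⁻¹) * ‖w‖ ≤ (1 - r⁻¹) * r := by gcongr
      _ = 3 * δ := by rw [sub_mul, inv_mul_cancel₀ hr0.ne']; linarith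
  refine ⟨r⁻¹ • w, X.smul_mem _ (X.add_mem hy (X.smul_mem _ hg)), ?_, ?_, ?_⟩
  · rw [norm_smul, Real.norm_eq_abs, abs_of_pos (inv_pos.2 hr0), inv_mul_le_iff₀ hr0]
    linarith
  · have := (abs_le.1 ((abs_apply_le_norm _ t).trans hwz)).2
    rw [ContinuousMap.sub_apply] at this
    linarith
  · linarith [norm_sub_le_norm_sub_add_norm_sub y w (r⁻¹ • w)]

lemma glSlice_neg {E : Type*} [NormedAddCommGroup E] [NormedSpace ℝ E]
    (f : E →L[ℝ] ℝ) (ε : ℝ) : glSlice (-f) ε = -glSlice f ε := by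
  ext x
  simp [glSlice]

/-- A criterion for GL-spaces: linear functionals of norm at most one whose peaks can be
reached from each point `y` of the unit ball within distance almost `1 - φ y`. -/
lemma isGLSpace_of_forall_exists_linearMap {E : Type*} [NormedAddCommGroup E]
    [NormedSpace ℝ E]
    (H : ∀ x : E, ‖x‖ = 1 → ∀ ε : ℝ, 0 < ε → ∃ φ : E →ₗ[ℝ] ℝ, (∀ z, |φ z| ≤ ‖z‖) ∧
      1 - ε < |φ x| ∧ ∀ y, ‖y‖ ≤ 1 → ∀ δ > 0, ∃ z, ‖z‖ ≤ 1 ∧ 1 - δ ≤ φ z ∧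
        ‖y - z‖ ≤ 1 - φ y + δ) :
    IsGLSpace E := by
  intro x hx ε hε
  obtain ⟨φ, hφ, hφx, hpeak⟩ := H x hx ε hε
  set f : E →L[ℝ] ℝ := φ.mkContinuous 1 (by simpa using hφ)
  have hf : ∀ z, f z = φ z := fun _ => rfl
  have hf1 : ‖f‖ = 1 := by
    refine le_antisymm (φ.mkContinuous_norm_le zero_le_one _) ?_
    refine le_of_forall_pos_le_add fun η hη => ?_
    obtain ⟨z, hz1, hzt, -⟩ := hpeak 0 (by simp) η hη
    have h1 := f.le_opNorm_of_le hz1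
    rw [hf, Real.norm_eq_abs, mul_one] at h1
    linarith [le_abs_self (φ z)]
  have key : ∀ y : E, ‖y‖ = 1 → infDist y (glSlice f ε) ≤ 1 - f y + ε / 4 := by
    intro y hy
    obtain ⟨z, hz1, hzt, hyz⟩ := hpeak y hy.le (ε / 4) (by positivity)
    have hmem : z ∈ glSlice f ε := ⟨hz1, by rw [hf]; linarith⟩
    exact (infDist_le_dist_of_mem hmem).trans (by rwa [hf, dist_eq_norm])
  have hfd : ∀ y : E, ‖y‖ = 1 →
      infDist y (glSlice f ε) + infDist y (-(glSlice f ε)) < 2 + ε := by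
    intro y hy
    have hneg : infDist y (-(glSlice f ε)) = infDist (-y) (glSlice f ε) := by
      rw [← infDist_image (isometry_neg : Isometry (Neg.neg : E → E)), Set.image_neg_eq_neg,
        neg_neg]
    have h1 := key y hy
    have h2 := key (-y) (by rwa [norm_neg])
    rw [map_neg] at h2
    linarith
  rcases lt_abs.1 hφx with hpos | hneg
  · exact ⟨f, hf1, ⟨hx.le, hpos⟩, hfd⟩
  · refine ⟨-f, by rwa [norm_neg], ⟨hx.le, hneg⟩, fun y hy => ?_⟩
    rw [glSlice_neg, neg_neg, add_comm]
    exact hfd y hy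

open ContinuousMap in
/-- Example 2.6: every separable C-rich (closed) subspace of `C(K)` is a GL-space. -/
theorem stmt_4 {K : Type*} [TopologicalSpace K] [CompactSpace K] [T2Space K]
    (X : Subspace ℝ C(K, ℝ)) (hX : IsCRich X)
    [TopologicalSpace.SeparableSpace X] :
    IsGLSpace X := by
  refine isGLSpace_of_forall_exists_linearMap fun x hx ε hε => ?_
  have hU : IsOpen {s | max 0 (1 - ε) < |(x : C(K, ℝ)) s|} :=
    isOpen_lt continuous_const (by fun_prop)
  have hne : {s | max 0 (1 - ε) < |(x : C(K, ℝ)) s|}.Nonempty := by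
    by_contra! hcon
    have hle : ‖(x : C(K, ℝ))‖ ≤ max 0 (1 - ε) :=
      (ContinuousMap.norm_le _ (le_max_left _ _)).2 fun s =>
        not_lt.1 fun hs => (hcon ▸ hs : s ∈ (∅ : Set K))
    rw [show ‖(x : C(K, ℝ))‖ = 1 from hx] at hle
    exact absurd hle (not_le.2 (max_lt one_pos (by linarith)))
  obtain ⟨t, htU, ht⟩ := exists_forall_hasBump hX hU hne
  refine ⟨(ContinuousMap.evalCLM ℝ t).toLinearMap.comp X.subtype,
    fun z => abs_apply_le_norm (z : C(K, ℝ)) t, lt_of_le_of_lt (le_max_right _ _) htU,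
    fun y hy δ hδ => ?_⟩
  obtain ⟨z, hz, hz1, hzt, hyz⟩ := exists_near_peak y.2 hy (ht y y.2 (δ / 7) (by positivity))
  refine ⟨⟨z, hz⟩, hz1, ?_, ?_⟩
  · change 1 - δ ≤ z t
    linarith
  · change ‖(y : C(K, ℝ)) - z‖ ≤ 1 - (y : C(K, ℝ)) t + δ
    linarith
end

section
/- The space E = ℝ² equipped with the hexagonal norm ‖(ξ, η)‖ = max{|η|, |ξ| + |η|/2} is a GL-space. -/
open Metric Set

/-- In coordinates `(g, h)` carrying the norm to the hexagonal one, the face `h = 1` of the unit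
ball and its opposite are at total distance at most `2` from every point of the unit ball. -/
lemma exists_glSlice_of_hexagonal {E : Type*} [NormedAddCommGroup E] [NormedSpace ℝ E]
    (g h : E →ₗ[ℝ] ℝ) (hnorm : ∀ x : E, ‖x‖ = max |h x| (|g x| + |h x| / 2))
    (hsurj : ∀ s t : ℝ, ∃ z : E, g z = s ∧ h z = t)
    {x : E} (hx : ‖x‖ = 1) (hhx : h x = 1) {ε : ℝ} (hε : 0 < ε) :
    ∃ f : E →L[ℝ] ℝ, ‖f‖ = 1 ∧ x ∈ glSlice f ε ∧
      ∀ y : E, ‖y‖ = 1 →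
        infDist y (glSlice f ε) + infDist y (-(glSlice f ε)) < 2 + ε := by
  have hle : ∀ z : E, ‖h z‖ ≤ 1 * ‖z‖ := fun z => by
    rw [one_mul, hnorm z]
    exact le_max_left _ _
  refine ⟨h.mkContinuous 1 hle, ?_, ⟨hx.le, ?_⟩, fun y hy => ?_⟩
  · refine le_antisymm (h.mkContinuous_norm_le zero_le_one hle) ?_
    have := (h.mkContinuous 1 hle).le_opNorm x
    simpa [hx, hhx] using this
  · rw [LinearMap.mkContinuous_apply, hhx]
    linarith
  · have hy1 : |h y| ≤ 1 := by
      rw [← hy, hnorm y]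
      exact le_max_left _ _
    have hy2 : |g y| + |h y| / 2 ≤ 1 := by
      rw [← hy, hnorm y]
      exact le_max_right _ _
    obtain ⟨c, hc, hc1, hc2⟩ : ∃ c : ℝ, |c| ≤ 1 / 2 ∧ |g y - c| ≤ (1 - h y) / 2 ∧
        |g y - c| ≤ (1 + h y) / 2 := by
      have h1 := abs_le.1 hy1
      have h2 := le_abs_self (h y)
      have h3 := neg_le_abs (h y)
      have h4 := le_abs_self (g y)
      have h5 := neg_le_abs (g y)
      rcases le_total (g y) (-(1 / 2)) with h6 | h6
      · refine ⟨-(1 / 2), ?_, ?_, ?_⟩ <;> rw [abs_le] <;> constructor <;> linarith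
      · rcases le_total (g y) (1 / 2) with h7 | h7
        · refine ⟨g y, ?_, ?_, ?_⟩ <;> rw [abs_le] <;> constructor <;> linarith
        · refine ⟨1 / 2, ?_, ?_, ?_⟩ <;> rw [abs_le] <;> constructor <;> linarith
    obtain ⟨hl, hr⟩ := abs_le.1 hy1
    obtain ⟨u, hgu, hhu⟩ := hsurj c 1
    obtain ⟨v, hgv, hhv⟩ := hsurj c (-1)
    have hu : u ∈ glSlice (h.mkContinuous 1 hle) ε := by
      refine ⟨?_, ?_⟩
      · rw [hnorm, hgu, hhu, abs_one]
        exact max_le le_rfl (by linarith)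
      · rw [LinearMap.mkContinuous_apply, hhu]
        linarith
    have hv : v ∈ -glSlice (h.mkContinuous 1 hle) ε := by
      refine ⟨?_, ?_⟩
      · rw [norm_neg, hnorm, hgv, hhv, abs_neg, abs_one]
        exact max_le le_rfl (by linarith)
      · rw [LinearMap.mkContinuous_apply, map_neg, hhv]
        linarith
    have hdu : dist y u ≤ 1 - h y := by
      rw [dist_eq_norm, hnorm, map_sub, map_sub, hgu, hhu,
        abs_of_nonpos (by linarith : h y - 1 ≤ 0)]
      exact max_le (by linarith) (by linarith)
    have hdv : dist y v ≤ 1 + h y := by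
      rw [dist_eq_norm, hnorm, map_sub, map_sub, hgv, hhv,
        abs_of_nonneg (by linarith : 0 ≤ h y - -1)]
      exact max_le (by linarith) (by linarith)
    linarith [infDist_le_dist_of_mem (x := y) hu, infDist_le_dist_of_mem (x := y) hv]

/-- The version of `exists_glSlice_of_hexagonal` for a point of either face `h = ±1`. -/
lemma exists_glSlice_of_hexagonal_of_abs {E : Type*} [NormedAddCommGroup E] [NormedSpace ℝ E]
    (g h : E →ₗ[ℝ] ℝ) (hnorm : ∀ x : E, ‖x‖ = max |h x| (|g x| + |h x| / 2))
    (hsurj : ∀ s t : ℝ, ∃ z : E, g z = s ∧ h z = t)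
    {x : E} (hx : ‖x‖ = 1) (hhx : |h x| = 1) {ε : ℝ} (hε : 0 < ε) :
    ∃ f : E →L[ℝ] ℝ, ‖f‖ = 1 ∧ x ∈ glSlice f ε ∧
      ∀ y : E, ‖y‖ = 1 →
        infDist y (glSlice f ε) + infDist y (-(glSlice f ε)) < 2 + ε := by
  rcases eq_or_eq_neg_of_abs_eq hhx with h1 | h1
  · exact exists_glSlice_of_hexagonal g h hnorm hsurj hx h1 hε
  · refine exists_glSlice_of_hexagonal g (-h) (by simpa using hnorm) (fun s t => ?_) hx
      (by simp [h1]) hε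
    obtain ⟨z, hz, hz'⟩ := hsurj s (-t)
    exact ⟨z, hz, by simp [hz']⟩

/-- The hexagonal norm is invariant under the linear map of order six rotating the hexagon. -/
lemma hexagonal_rotate (a b : ℝ) :
    max |b| (|a| + |b| / 2) =
      max |a + b / 2| (|3 / 4 * b - a / 2| + |a + b / 2| / 2) := by
  grind [abs_cases]

/-- The hexagonal norm is invariant under the inverse of the rotation of the hexagon. -/
lemma hexagonal_rotate_symm (a b : ℝ) :
    max |b| (|a| + |b| / 2) =
      max |a - b / 2| (|3 / 4 * b + a / 2| + |a - b / 2| / 2) := by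
  have := hexagonal_rotate a (-b)
  rw [abs_neg] at this
  rw [this, ← abs_neg (3 / 4 * b + a / 2)]
  ring_nf

/-- Example 2.7: the two-dimensional space with hexagonal norm
`‖(ξ, η)‖ = max {|η|, |ξ| + |η|/2}` is a GL-space.  We formalize this by taking any real
normed space `E` that is linearly isomorphic to `ℝ²` via `e` in such a way that the norm
of `E` is carried to the hexagonal norm. -/
theorem stmt_5 {E : Type*} [NormedAddCommGroup E] [NormedSpace ℝ E]
    (e : E ≃ₗ[ℝ] ℝ × ℝ)
    (hnorm : ∀ x : E, ‖x‖ = max |(e x).2| (|(e x).1| + |(e x).2| / 2)) :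
    IsGLSpace E := by
  intro x hx ε hε
  set p : E →ₗ[ℝ] ℝ := LinearMap.fst ℝ ℝ ℝ ∘ₗ e.toLinearMap
  set q : E →ₗ[ℝ] ℝ := LinearMap.snd ℝ ℝ ℝ ∘ₗ e.toLinearMap
  have hpq : ∀ z, ‖z‖ = max |q z| (|p z| + |q z| / 2) := hnorm
  have hsurj : ∀ s t : ℝ, ∃ z : E, p z = s ∧ q z = t := fun s t =>
    ⟨e.symm (s, t), by simp [p], by simp [q]⟩
  have hface : |q x| = 1 ∨ |p x + q x / 2| = 1 ∨ |p x - q x / 2| = 1 := by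
    have := hpq x
    rw [hx] at this
    grind [abs_cases]
  rcases hface with h | h | h
  · exact exists_glSlice_of_hexagonal_of_abs p q hpq hsurj hx h hε
  · refine exists_glSlice_of_hexagonal_of_abs ((3 / 4 : ℝ) • q - (1 / 2 : ℝ) • p)
      (p + (1 / 2 : ℝ) • q) (fun z => ?_) (fun s t => ?_) hx ?_ hε
    · rw [hpq z, hexagonal_rotate]
      simp only [LinearMap.add_apply, LinearMap.sub_apply, LinearMap.smul_apply, smul_eq_mul]
      ring_nf
    · obtain ⟨z, hz, hz'⟩ := hsurj (3 / 4 * t - s / 2) (s + t / 2)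
      refine ⟨z, ?_, ?_⟩ <;>
        simp only [LinearMap.add_apply, LinearMap.sub_apply, LinearMap.smul_apply, smul_eq_mul,
          hz, hz'] <;> ring
    · convert h using 2
      simp only [LinearMap.add_apply, LinearMap.smul_apply, smul_eq_mul]
      ring
  · refine exists_glSlice_of_hexagonal_of_abs ((3 / 4 : ℝ) • q + (1 / 2 : ℝ) • p)
      (p - (1 / 2 : ℝ) • q) (fun z => ?_) (fun s t => ?_) hx ?_ hε
    · rw [hpq z, hexagonal_rotate_symm]
      simp only [LinearMap.add_apply, LinearMap.sub_apply, LinearMap.smul_apply, smul_eq_mul]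
      ring_nf
    · obtain ⟨z, hz, hz'⟩ := hsurj (s / 2 + 3 / 4 * t) (s - t / 2)
      refine ⟨z, ?_, ?_⟩ <;>
        simp only [LinearMap.add_apply, LinearMap.sub_apply, LinearMap.smul_apply, smul_eq_mul,
          hz, hz'] <;> ring
    · convert h using 2
      simp only [LinearMap.sub_apply, LinearMap.smul_apply, smul_eq_mul]
      ring
end

section
/- If E is a real GL-space, then for every x ∈ S_E and every ε > 0 there exists x* ∈ S_{E*} such that x ∈ S(x*, ε) and dist(y, S(x*, ε)) + dist(y, −S(x*, ε)) < 2 + ε for ALL y in the closed unit ball B_E (not only for y ∈ S_E). -/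
open Metric Set

/-- The distance to a nonempty convex set is a convex function. -/
theorem convexOn_infDist_of_convex {E : Type*} [NormedAddCommGroup E] [NormedSpace ℝ E]
    {s : Set E} (hs : Convex ℝ s) (hne : s.Nonempty) :
    ConvexOn ℝ univ (fun y => infDist y s) := by
  refine ⟨convex_univ, fun y _ z _ a b ha hb hab => ?_⟩
  refine le_of_forall_pos_lt_add fun δ hδ => ?_
  obtain ⟨p, hp, hyp⟩ := (infDist_lt_iff hne).1 (lt_add_of_pos_right (infDist y s) hδ)
  obtain ⟨q, hq, hzq⟩ := (infDist_lt_iff hne).1 (lt_add_of_pos_right (infDist z s) hδ)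
  have hle : dist (a • y + b • z) (a • p + b • q) ≤ a * dist y p + b * dist z q :=
    (dist_add_add_le _ _ _ _).trans_eq (by
      rw [dist_smul₀, dist_smul₀, Real.norm_of_nonneg ha, Real.norm_of_nonneg hb])
  have hlt : a * dist y p + b * dist z q < a * (infDist y s + δ) + b * (infDist z s + δ) := by
    rcases ha.eq_or_lt with rfl | ha'
    · have hb1 : b = 1 := by linarith
      subst hb1
      linarith
    · exact add_lt_add_of_lt_of_le (mul_lt_mul_of_pos_left hyp ha')
        (mul_le_mul_of_nonneg_left hzq.le hb)
  calc infDist (a • y + b • z) s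
      ≤ dist (a • y + b • z) (a • p + b • q) := infDist_le_dist_of_mem (hs hp hq ha hb hab)
    _ < a * (infDist y s + δ) + b * (infDist z s + δ) := hle.trans_lt hlt
    _ = a * infDist y s + b * infDist z s + (a + b) * δ := by ring
    _ = a • infDist y s + b • infDist z s + δ := by rw [hab, one_mul, smul_eq_mul, smul_eq_mul]

/-- In a nontrivial normed space, a convex function that is smaller than `c` on the unit sphere
is smaller than `c` on the closed unit ball. -/
theorem ConvexOn.lt_of_norm_le_one {E : Type*} [NormedAddCommGroup E] [NormedSpace ℝ E]
    [Nontrivial E] {g : E → ℝ} (hg : ConvexOn ℝ univ g) {c : ℝ}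
    (h : ∀ y : E, ‖y‖ = 1 → g y < c) {y : E} (hy : ‖y‖ ≤ 1) : g y < c := by
  obtain ⟨u, hu, hyu⟩ : ∃ u : E, ‖u‖ = 1 ∧ y = ‖y‖ • u := by
    rcases eq_or_ne y 0 with rfl | hy0
    · obtain ⟨u, hu⟩ := exists_norm_eq E zero_le_one
      exact ⟨u, hu, by simp⟩
    · exact ⟨‖y‖⁻¹ • y, by rw [norm_smul, norm_inv, norm_norm, inv_mul_cancel₀ (norm_ne_zero_iff.2 hy0)],
        (smul_inv_smul₀ (norm_ne_zero_iff.2 hy0) y).symm⟩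
  have hseg : y ∈ segment ℝ u (-u) := by
    refine ⟨(1 + ‖y‖) / 2, (1 - ‖y‖) / 2, by positivity, by linarith, by ring, ?_⟩
    conv_rhs => rw [hyu]
    module
  exact (hg.le_on_segment (mem_univ u) (mem_univ (-u)) hseg).trans_lt
    (max_lt (h u hu) (h (-u) (by rwa [norm_neg])))

/-- Lemma 2.9: if `E` is a GL-space then the defining estimate holds for every `y` in the
closed unit ball, not only on the unit sphere. -/
theorem stmt_6 {E : Type*} [NormedAddCommGroup E] [NormedSpace ℝ E] [CompleteSpace E]
    (hE : IsGLSpace E) :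
    ∀ x : E, ‖x‖ = 1 → ∀ ε : ℝ, 0 < ε →
      ∃ f : E →L[ℝ] ℝ, ‖f‖ = 1 ∧ x ∈ glSlice f ε ∧
        ∀ y : E, ‖y‖ ≤ 1 →
          infDist y (glSlice f ε) + infDist y (-(glSlice f ε)) < 2 + ε := by
  intro x hx ε hε
  obtain ⟨f, hf, hxf, h⟩ := hE x hx ε hε
  have : Nontrivial E := ⟨x, 0, norm_ne_zero_iff.1 (hx.symm ▸ one_ne_zero)⟩
  have hconv := (convexOn_infDist_of_convex (convex_glSlice f ε) ⟨x, hxf⟩).add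
    (convexOn_infDist_of_convex (convex_glSlice f ε).neg (Set.Nonempty.neg ⟨x, hxf⟩))
  exact ⟨f, hf, hxf, fun y hy => hconv.lt_of_norm_le_one h hy⟩
end

section
/- Let {E_λ : λ ∈ Λ} be a family of real Banach spaces and let E = (⊕_{λ ∈ Λ} E_λ)_{ℓ₁} be their ℓ₁-sum, i.e. the space of all families (x_λ) with x_λ ∈ E_λ and ∑_λ ‖x_λ‖ < ∞, normed by ‖(x_λ)‖ = ∑_λ ‖x_λ‖. Then E is a GL-space if and only if every E_λ is a GL-space. -/
open Metric Set

/-- A positively homogeneous form of the condition on `f` in the definition of a GL-space,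
with points of the slice replaced by points `u`, `v` of norm at most `‖y‖`. -/
def IsGLFunctional {E : Type*} [NormedAddCommGroup E] [NormedSpace ℝ E]
    (f : E →L[ℝ] ℝ) (ε : ℝ) : Prop :=
  ‖f‖ ≤ 1 ∧ ∀ y : E, ∃ u v : E, ‖u‖ ≤ ‖y‖ ∧ ‖v‖ ≤ ‖y‖ ∧
    (1 - ε) * ‖y‖ ≤ f u ∧ (1 - ε) * ‖y‖ ≤ f v ∧ ‖y - u‖ + ‖y + v‖ ≤ (2 + ε) * ‖y‖

section Homogeneous

variable {E : Type*} [NormedAddCommGroup E] [NormedSpace ℝ E]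

theorem isGLFunctional_of_unit {f : E →L[ℝ] ℝ} {ε : ℝ} (hf : ‖f‖ ≤ 1)
    (h : ∀ y : E, ‖y‖ = 1 → ∃ u v : E, ‖u‖ ≤ 1 ∧ ‖v‖ ≤ 1 ∧
      1 - ε ≤ f u ∧ 1 - ε ≤ f v ∧ ‖y - u‖ + ‖y + v‖ ≤ 2 + ε) :
    IsGLFunctional f ε := by
  refine ⟨hf, fun y => ?_⟩
  rcases eq_or_ne y 0 with rfl | hy
  · exact ⟨0, 0, by simp⟩
  have hy0 : 0 < ‖y‖ := norm_pos_iff.2 hy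
  obtain ⟨u, v, hu, hv, hfu, hfv, huv⟩ := h (‖y‖⁻¹ • y) (norm_smul_inv_norm hy)
  have hyy : y = ‖y‖ • (‖y‖⁻¹ • y) := by rw [smul_inv_smul₀ hy0.ne']
  have h1 : ‖y - ‖y‖ • u‖ = ‖y‖ * ‖‖y‖⁻¹ • y - u‖ := by
    conv_lhs => rw [hyy, norm_smul, norm_norm, norm_smul, norm_inv, norm_norm,
      inv_mul_cancel₀ hy0.ne', mul_one, ← smul_sub, norm_smul, norm_norm]
  have h2 : ‖y + ‖y‖ • v‖ = ‖y‖ * ‖‖y‖⁻¹ • y + v‖ := by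
    conv_lhs => rw [hyy, norm_smul, norm_norm, norm_smul, norm_inv, norm_norm,
      inv_mul_cancel₀ hy0.ne', mul_one, ← smul_add, norm_smul, norm_norm]
  refine ⟨‖y‖ • u, ‖y‖ • v, ?_, ?_, ?_, ?_, ?_⟩
  · rw [norm_smul, norm_norm]; nlinarith
  · rw [norm_smul, norm_norm]; nlinarith
  · rw [map_smul, smul_eq_mul]; nlinarith
  · rw [map_smul, smul_eq_mul]; nlinarith
  · rw [h1, h2]; nlinarith

theorem IsGLSpace.exists_isGLFunctional_of_norm_eq_one (h : IsGLSpace E) {x : E} (hx : ‖x‖ = 1)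
    {ε : ℝ} (hε : 0 < ε) : ∃ f : E →L[ℝ] ℝ, IsGLFunctional f ε ∧ 1 - ε ≤ f x := by
  obtain ⟨f, hf, hxf, hd⟩ := h x hx ε hε
  refine ⟨f, isGLFunctional_of_unit hf.le fun y hy => ?_, hxf.2.le⟩
  have hy' := hd y hy
  have hne : (glSlice f ε).Nonempty := ⟨x, hxf⟩
  obtain ⟨r, hr, hr'⟩ := exists_between (lt_sub_iff_add_lt.2 hy')
  obtain ⟨u, hu, hyu⟩ := (infDist_lt_iff hne).1 hr
  obtain ⟨v, hv, hyv⟩ := (infDist_lt_iff hne.neg).1 (lt_sub_comm.1 hr')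
  rw [dist_eq_norm] at hyu hyv
  refine ⟨u, -v, hu.1, hv.1, hu.2.le, hv.2.le, ?_⟩
  rw [← sub_eq_add_neg]
  linarith

theorem IsGLSpace.exists_isGLFunctional (h : IsGLSpace E) (x : E) {ε : ℝ} (hε : 0 < ε) :
    ∃ f : E →L[ℝ] ℝ, IsGLFunctional f ε ∧ (1 - ε) * ‖x‖ ≤ f x := by
  rcases eq_or_ne x 0 with rfl | hx
  · rcases subsingleton_or_nontrivial E with hE | hE
    · exact ⟨0, ⟨by simp, fun y => ⟨0, 0, by simp [Subsingleton.elim y 0]⟩⟩, by simp⟩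
    · obtain ⟨z, hz⟩ := exists_norm_eq E zero_le_one
      obtain ⟨f, hf, -⟩ := h.exists_isGLFunctional_of_norm_eq_one hz hε
      exact ⟨f, hf, by simp⟩
  · have hx0 : 0 < ‖x‖ := norm_pos_iff.2 hx
    obtain ⟨f, hf, hfx⟩ := h.exists_isGLFunctional_of_norm_eq_one
      (x := ‖x‖⁻¹ • x) (norm_smul_inv_norm hx) hε
    refine ⟨f, hf, ?_⟩
    rwa [map_smul, smul_eq_mul, inv_mul_eq_div, le_div_iff₀ hx0] at hfx

theorem isGLSpace_of_exists_isGLFunctional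
    (h : ∀ x : E, ‖x‖ = 1 → ∀ ε : ℝ, 0 < ε →
      ∃ f : E →L[ℝ] ℝ, IsGLFunctional f ε ∧ 1 - ε ≤ f x) : IsGLSpace E := by
  intro x hx ε hε
  obtain ⟨δ, hδ, hδ'⟩ := exists_between (lt_min hε one_pos)
  obtain ⟨hδε, hδ1⟩ := lt_min_iff.1 hδ'
  obtain ⟨f, ⟨hf, hfy⟩, hfx⟩ := h x hx δ hδ
  have hf0 : 0 < ‖f‖ := by
    have := f.le_opNorm x
    rw [hx, mul_one, Real.norm_eq_abs] at this
    linarith [le_abs_self (f x)]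
  have key : ∀ u : E, ‖u‖ ≤ 1 → 1 - δ ≤ f u → u ∈ glSlice (‖f‖⁻¹ • f) ε := by
    intro u hu hfu
    refine ⟨hu, ?_⟩
    have : f u ≤ ‖f‖⁻¹ * f u := le_mul_of_one_le_left (by linarith) ((one_le_inv₀ hf0).2 hf)
    change 1 - ε < ‖f‖⁻¹ * f u
    linarith
  refine ⟨‖f‖⁻¹ • f, norm_smul_inv_norm (norm_pos_iff.1 hf0), key x hx.le hfx, fun y hy => ?_⟩
  obtain ⟨u, v, hu, hv, hfu, hfv, huv⟩ := hfy y
  rw [hy] at hu hv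
  rw [hy, mul_one] at hfu hfv huv
  have h1 := infDist_le_dist_of_mem (x := y) (key u hu hfu)
  have h2 := infDist_le_dist_of_mem (x := y) (Set.neg_mem_neg.2 (key v hv hfv))
  rw [dist_eq_norm] at h1 h2
  rw [sub_neg_eq_add] at h2
  linarith

end Homogeneous

section LOneSum

variable {Λ : Type*} {E : Λ → Type*} [∀ l, NormedAddCommGroup (E l)]

theorem lp.hasSum_norm_one (x : lp E 1) : HasSum (fun l => ‖x l‖) ‖x‖ := by
  simpa using lp.hasSum_norm (by simp) x

theorem memℓp_one_of_norm_le (y : lp E 1) {u : ∀ l, E l} (hu : ∀ l, ‖u l‖ ≤ ‖y l‖) :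
    Memℓp u 1 := by
  refine memℓp_gen ?_
  simpa using (lp.hasSum_norm_one y).summable.of_nonneg_of_le (fun _ => norm_nonneg _) hu

theorem lp.norm_eq_norm_add_norm_sub_single [DecidableEq Λ] (z : lp E 1) (l : Λ) :
    ‖z‖ = ‖z l‖ + ‖z - lp.single 1 l (z l)‖ := by
  have := lp.norm_sub_norm_compl_sub_single (by simp) z {l}
  simp only [ENNReal.toReal_one, Real.rpow_one, Finset.sum_singleton] at this
  linarith

variable [∀ l, NormedSpace ℝ (E l)]

theorem summable_apply_of_norm_le_one {f : ∀ l, E l →L[ℝ] ℝ} (hf : ∀ l, ‖f l‖ ≤ 1) (x : lp E 1) :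
    Summable fun l => f l (x l) :=
  (lp.hasSum_norm_one x).summable.of_norm_bounded fun l =>
    ((f l).le_of_opNorm_le_of_le (hf l) le_rfl).trans_eq (one_mul _)

/-- The functional on an `ℓ¹`-sum given by a family of functionals of norm at most one. -/
noncomputable def lOneFunctional (f : ∀ l, E l →L[ℝ] ℝ) (hf : ∀ l, ‖f l‖ ≤ 1) :
    lp E 1 →L[ℝ] ℝ :=
  LinearMap.mkContinuous
    { toFun := fun x => ∑' l, f l (x l)
      map_add' := fun x y => by
        simp only [lp.coeFn_add, Pi.add_apply, map_add]
        exact (summable_apply_of_norm_le_one hf x).tsum_add (summable_apply_of_norm_le_one hf y)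
      map_smul' := fun c x => by
        simp only [lp.coeFn_smul, Pi.smul_apply, map_smul, smul_eq_mul, RingHom.id_apply]
        exact tsum_mul_left }
    1 fun x => by
      rw [one_mul]
      exact tsum_of_norm_bounded (lp.hasSum_norm_one x) fun l =>
        ((f l).le_of_opNorm_le_of_le (hf l) le_rfl).trans_eq (one_mul _)

theorem le_lOneFunctional {f : ∀ l, E l →L[ℝ] ℝ} (hf : ∀ l, ‖f l‖ ≤ 1) {c : ℝ} {x y : lp E 1}
    (h : ∀ l, c * ‖y l‖ ≤ f l (x l)) : c * ‖y‖ ≤ lOneFunctional f hf x :=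
  hasSum_le h ((lp.hasSum_norm_one y).mul_left c) (summable_apply_of_norm_le_one hf x).hasSum

theorem isGLFunctional_lOneFunctional {f : ∀ l, E l →L[ℝ] ℝ} {ε : ℝ}
    (hf : ∀ l, IsGLFunctional (f l) ε) :
    IsGLFunctional (lOneFunctional f fun l => (hf l).1) ε := by
  refine ⟨LinearMap.mkContinuous_norm_le _ zero_le_one _, fun y => ?_⟩
  choose u v hu hv hfu hfv huv using fun l => (hf l).2 (y l)
  let U : lp E 1 := ⟨u, memℓp_one_of_norm_le y hu⟩
  let V : lp E 1 := ⟨v, memℓp_one_of_norm_le y hv⟩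
  exact ⟨U, V, hasSum_le hu (lp.hasSum_norm_one U) (lp.hasSum_norm_one y),
    hasSum_le hv (lp.hasSum_norm_one V) (lp.hasSum_norm_one y),
    le_lOneFunctional _ hfu, le_lOneFunctional _ hfv,
    hasSum_le huv ((lp.hasSum_norm_one (y - U)).add (lp.hasSum_norm_one (y + V)))
      ((lp.hasSum_norm_one y).mul_left _)⟩

/-- A point of the `ℓ¹`-sum is moved into the summand `E l` by replacing its off-`l` part with a
multiple of `x`. This does not increase the distance to points of `E l`. -/
theorem lp.exists_summand_approx [DecidableEq Λ] {f : lp E 1 →L[ℝ] ℝ} (hf : ‖f‖ ≤ 1) {δ : ℝ}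
    (hδ : 0 < δ) {l : Λ} {x : E l} (hx : ‖x‖ = 1) (hfx : 1 - δ ≤ f (lp.single 1 l x))
    {u : lp E 1} (hu : ‖u‖ ≤ 1) (hfu : 1 - δ ≤ f u) :
    ∃ w : E l, ‖w‖ ≤ 1 ∧ 1 - 2 * δ ≤ f (lp.single 1 l w) ∧
      ∀ y : E l, ‖y - w‖ ≤ ‖lp.single 1 l y - u‖ := by
  set a := ‖u - lp.single 1 l (u l)‖ with ha
  have ha0 : 0 ≤ a := norm_nonneg _
  have hua : ‖u‖ = ‖u l‖ + a := lp.norm_eq_norm_add_norm_sub_single u l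
  have hax : ‖a • x‖ = a := by rw [norm_smul, hx, mul_one, Real.norm_of_nonneg ha0]
  refine ⟨u l + a • x, ?_, ?_, fun y => ?_⟩
  · linarith [norm_add_le (u l) (a • x)]
  · have h1 : f (u - lp.single 1 l (u l)) ≤ a :=
      (le_abs_self _).trans ((f.le_of_opNorm_le hf _).trans_eq (one_mul _))
    rw [map_sub] at h1
    rw [lp.single_add, lp.single_smul, map_add, map_smul, smul_eq_mul]
    nlinarith [norm_nonneg (u l)]
  · have h2 := lp.norm_eq_norm_add_norm_sub_single (lp.single 1 l y - u) l
    have h3 : ‖lp.single 1 l y - u - lp.single 1 l ((lp.single 1 l y - u) l)‖ = a := by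
      rw [ha, ← norm_neg]
      congr 1
      simp only [lp.coeFn_sub, Pi.sub_apply, lp.single_apply_self, lp.single_sub]
      abel
    rw [h3, lp.coeFn_sub, Pi.sub_apply, lp.single_apply_self] at h2
    rw [h2, ← sub_sub]
    exact (norm_sub_le _ _).trans_eq (by rw [hax])

theorem IsGLSpace.of_lp_one (h : IsGLSpace (lp E 1)) (l : Λ) : IsGLSpace (E l) := by
  classical
  refine isGLSpace_of_exists_isGLFunctional fun x hx ε hε => ?_
  have hsingle (z : E l) : ‖lp.single 1 l z‖ = ‖z‖ := lp.norm_single zero_lt_one l z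
  obtain ⟨f, ⟨hf, hfy⟩, hfx⟩ := h.exists_isGLFunctional_of_norm_eq_one
    (x := lp.single 1 l x) ((hsingle x).trans hx) (half_pos hε)
  refine ⟨f ∘L lp.singleContinuousLinearMap ℝ E 1 l,
    isGLFunctional_of_unit ?_ fun y hy => ?_, ?_⟩
  · refine ContinuousLinearMap.opNorm_le_bound _ zero_le_one fun z => ?_
    exact f.le_of_opNorm_le_of_le hf (hsingle z).le
  · obtain ⟨u, v, hu, hv, hfu, hfv, huv⟩ := hfy (lp.single 1 l y)
    rw [hsingle, hy] at hu hv
    rw [hsingle, hy, mul_one] at hfu hfv huv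
    obtain ⟨u', hu', hfu', hyu'⟩ := lp.exists_summand_approx hf (half_pos hε) hx hfx hu hfu
    obtain ⟨v', hv', hfv', hyv'⟩ := lp.exists_summand_approx hf (half_pos hε) hx hfx hv hfv
    rw [mul_div_cancel₀ _ two_ne_zero] at hfu' hfv'
    refine ⟨u', v', hu', hv', hfu', hfv', ?_⟩
    have h1 := hyu' y
    have h2 := hyv' (-y)
    rw [lp.single_neg, ← neg_add', norm_neg, ← neg_add', norm_neg] at h2
    linarith
  · change 1 - ε ≤ f (lp.single 1 l x)
    linarith

theorem IsGLSpace.lp_one (h : ∀ l, IsGLSpace (E l)) : IsGLSpace (lp E 1) := by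
  refine isGLSpace_of_exists_isGLFunctional fun x hx ε hε => ?_
  choose f hf hfx using fun l => (h l).exists_isGLFunctional (x l) hε
  refine ⟨_, isGLFunctional_lOneFunctional hf, ?_⟩
  simpa [hx] using le_lOneFunctional (fun l => (hf l).1) hfx

end LOneSum

/-- Theorem 2.11 (ℓ₁-sum case): the ℓ₁-sum `(⊕_λ E_λ)_{ℓ₁}` of a family of Banach spaces
is a GL-space if and only if every summand `E_λ` is a GL-space. -/
theorem stmt_8 {Λ : Type*} (E : Λ → Type*) [∀ l, NormedAddCommGroup (E l)]
    [∀ l, NormedSpace ℝ (E l)] [∀ l, CompleteSpace (E l)] :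
    IsGLSpace (lp E 1) ↔ ∀ l, IsGLSpace (E l) :=
  ⟨fun h l => h.of_lp_one l, IsGLSpace.lp_one⟩
end

section
/- Let {E_λ : λ ∈ Λ} be a family of real GL-spaces and let E = (⊕_{λ ∈ Λ} E_λ)_{ℓ∞} be their ℓ∞-sum, i.e. the space of all bounded families (x_λ) with x_λ ∈ E_λ, normed by ‖(x_λ)‖ = sup_λ ‖x_λ‖. Then E is a GL-space. -/
open Metric Set

theorem glSlice_mono {E : Type*} [NormedAddCommGroup E] [NormedSpace ℝ E]
    (f : E →L[ℝ] ℝ) {ε δ : ℝ} (h : ε ≤ δ) : glSlice f ε ⊆ glSlice f δ :=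
  fun _ hx => ⟨hx.1, by linarith [hx.2]⟩

/-- If `v` is close to both a convex set `S` and its negative, then so is every point of the
segment from `-v` to `v`, with the same bound on the sum of the distances. -/
theorem Convex.exists_norm_sub_add_norm_add_lt_of_smul {E : Type*} [NormedAddCommGroup E]
    [NormedSpace ℝ E] {S : Set E} (hS : Convex ℝ S) {v : E} {c : ℝ}
    (hv : ∃ z ∈ S, ∃ w ∈ S, ‖v - z‖ + ‖v + w‖ < c) {t : ℝ} (ht₀ : 0 ≤ t) (ht₁ : t ≤ 1) :
    ∃ z ∈ S, ∃ w ∈ S, ‖t • v - z‖ + ‖t • v + w‖ < c := by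
  obtain ⟨z, hz, w, hw, h⟩ := hv
  have ha : 0 ≤ (1 + t) / 2 := by linarith
  have hb : 0 ≤ (1 - t) / 2 := by linarith
  refine ⟨((1 + t) / 2) • z + ((1 - t) / 2) • w, hS hz hw ha hb (by ring),
    ((1 + t) / 2) • w + ((1 - t) / 2) • z, hS hw hz ha hb (by ring), ?_⟩
  have h₁ : t • v - (((1 + t) / 2) • z + ((1 - t) / 2) • w)
      = ((1 + t) / 2) • (v - z) - ((1 - t) / 2) • (v + w) := by module
  have h₂ : t • v + (((1 + t) / 2) • w + ((1 - t) / 2) • z)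
      = ((1 + t) / 2) • (v + w) - ((1 - t) / 2) • (v - z) := by module
  have n₁ := norm_sub_le (((1 + t) / 2) • (v - z)) (((1 - t) / 2) • (v + w))
  have n₂ := norm_sub_le (((1 + t) / 2) • (v + w)) (((1 - t) / 2) • (v - z))
  rw [h₁, h₂]
  simp only [norm_smul_of_nonneg ha, norm_smul_of_nonneg hb] at n₁ n₂
  linarith

theorem exists_norm_sub_add_norm_add_lt_of_infDist {E : Type*} [NormedAddCommGroup E]
    {S : Set E} (hS : S.Nonempty) {v : E} {c : ℝ} (h : infDist v S + infDist v (-S) < c) :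
    ∃ z ∈ S, ∃ w ∈ S, ‖v - z‖ + ‖v + w‖ < c := by
  obtain ⟨z, hz, hvz⟩ := (infDist_lt_iff hS).1 (lt_sub_iff_add_lt.2 h)
  obtain ⟨w, hw, hvw⟩ := (infDist_lt_iff hS.neg).1 (lt_sub_comm.1 hvz)
  refine ⟨z, hz, -w, hw, ?_⟩
  simp only [dist_eq_norm] at hvw
  rw [← sub_eq_add_neg]
  linarith

theorem infDist_add_infDist_neg_lt {E : Type*} [NormedAddCommGroup E]
    {S : Set E} {v : E} {c : ℝ} (h : ∃ z ∈ S, ∃ w ∈ S, ‖v - z‖ + ‖v + w‖ < c) :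
    infDist v S + infDist v (-S) < c := by
  obtain ⟨z, hz, w, hw, h⟩ := h
  have h₁ := infDist_le_dist_of_mem (x := v) hz
  have h₂ := infDist_le_dist_of_mem (x := v) (Set.neg_mem_neg.2 hw)
  rw [dist_eq_norm] at h₁ h₂
  rw [sub_neg_eq_add] at h₂
  linarith

/-- In a GL-space, one may choose a slice near a given unit vector which is suitable for all
points of the unit ball rather than just those of the unit sphere. -/
theorem IsGLSpace.exists_glSlice_closedBall {E : Type*} [NormedAddCommGroup E] [NormedSpace ℝ E]
    (hE : IsGLSpace E) {x : E} (hx : ‖x‖ = 1) {ε : ℝ} (hε : 0 < ε) :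
    ∃ f : E →L[ℝ] ℝ, ‖f‖ = 1 ∧ x ∈ glSlice f ε ∧ ∀ y : E, ‖y‖ ≤ 1 →
      ∃ z ∈ glSlice f ε, ∃ w ∈ glSlice f ε, ‖y - z‖ + ‖y + w‖ < 2 + ε := by
  obtain ⟨f, hf, hxf, h⟩ := hE x hx ε hε
  refine ⟨f, hf, hxf, fun y hy => ?_⟩
  obtain ⟨v, hv, hvy⟩ : ∃ v : E, ‖v‖ = 1 ∧ ‖y‖ • v = y := by
    rcases eq_or_ne y 0 with rfl | hy₀
    · exact ⟨x, hx, by simp⟩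
    · exact ⟨‖y‖⁻¹ • y, norm_smul_inv_norm hy₀, smul_inv_smul₀ (norm_ne_zero_iff.2 hy₀) y⟩
  rw [← hvy]
  exact (convex_glSlice f ε).exists_norm_sub_add_norm_add_lt_of_smul
    (exists_norm_sub_add_norm_add_lt_of_infDist ⟨x, hxf⟩ (h v hv)) (norm_nonneg y) hy

section lp

variable {Λ : Type*} {E : Λ → Type*} [∀ l, NormedAddCommGroup (E l)] [∀ l, NormedSpace ℝ (E l)]

theorem norm_comp_evalCLM (l : Λ) (f : E l →L[ℝ] ℝ) :
    ‖f.comp (lp.evalCLM ℝ E ⊤ l)‖ = ‖f‖ := by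
  classical
  apply le_antisymm
  · refine ContinuousLinearMap.opNorm_le_bound _ (norm_nonneg f) fun x => ?_
    exact (f.le_opNorm _).trans (mul_le_mul_of_nonneg_left
      (lp.norm_apply_le_norm ENNReal.top_ne_zero x l) (norm_nonneg f))
  · refine ContinuousLinearMap.opNorm_le_bound _ (norm_nonneg _) fun z => ?_
    have h := (f.comp (lp.evalCLM ℝ E ⊤ l)).le_opNorm (lp.single ⊤ l z)
    rw [lp.norm_single ENNReal.zero_lt_top] at h
    simpa [lp.evalCLM] using h

/-- A point of the unit ball of the `ℓ∞`-sum can be moved into the slice of a functional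
depending on one coordinate by moving that coordinate only. -/
theorem exists_mem_glSlice_comp_evalCLM (l : Λ) (f : E l →L[ℝ] ℝ) {ε : ℝ} {y : lp E ⊤}
    (hy : ‖y‖ ≤ 1) {z : E l} (hz : z ∈ glSlice f ε) :
    ∃ w ∈ glSlice (f.comp (lp.evalCLM ℝ E ⊤ l)) ε, ‖y - w‖ = ‖y l - z‖ := by
  classical
  have hl : (y - lp.single ⊤ l (y l - z)) l = z := by
    simp
  refine ⟨y - lp.single ⊤ l (y l - z), ⟨?_, ?_⟩, ?_⟩
  · refine lp.norm_le_of_forall_le zero_le_one fun i => ?_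
    rcases eq_or_ne i l with rfl | hi
    · rw [hl]
      exact hz.1
    · simpa [hi] using (lp.norm_apply_le_norm ENNReal.top_ne_zero y i).trans hy
  · change 1 - ε < f ((y - lp.single ⊤ l (y l - z)) l)
    rw [hl]
    exact hz.2
  · rw [sub_sub_cancel, lp.norm_single ENNReal.zero_lt_top]

end lp

/-- Proposition 2.12: the ℓ∞-sum `(⊕_λ E_λ)_{ℓ∞}` of a family of GL-spaces is a
GL-space. -/
theorem stmt_10 {Λ : Type*} (E : Λ → Type*) [∀ l, NormedAddCommGroup (E l)]
    [∀ l, NormedSpace ℝ (E l)] [∀ l, CompleteSpace (E l)]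
    (hE : ∀ l, IsGLSpace (E l)) :
    IsGLSpace (lp E ⊤) := by
  intro x hx ε hε
  have : Nonempty Λ := by
    by_contra h
    rw [not_nonempty_iff] at h
    rw [lp.norm_eq_ciSup, Real.iSup_of_isEmpty] at hx
    exact zero_ne_one hx
  obtain ⟨δ, hδ₀, hδ₁, hδε⟩ : ∃ δ : ℝ, 0 < δ ∧ δ < 1 ∧ 2 * δ ≤ ε :=
    ⟨min ε 1 / 2, by positivity, by linarith [min_le_right ε 1], by linarith [min_le_left ε 1]⟩
  obtain ⟨l, hl⟩ : ∃ l, 1 - δ < ‖x l‖ :=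
    exists_lt_of_lt_ciSup (by rw [← lp.norm_eq_ciSup, hx]; linarith)
  have hxl : 0 < ‖x l‖ := by linarith
  obtain ⟨f, hf, hxf, h⟩ := (hE l).exists_glSlice_closedBall
    (norm_smul_inv_norm (𝕜 := ℝ) (norm_pos_iff.1 hxl)) hδ₀
  have hsub := glSlice_mono (f.comp (lp.evalCLM ℝ E ⊤ l)) (by linarith : δ ≤ ε)
  refine ⟨f.comp (lp.evalCLM ℝ E ⊤ l), by rw [norm_comp_evalCLM, hf], ⟨hx.le, ?_⟩,
    fun y hy => infDist_add_infDist_neg_lt ?_⟩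
  · change 1 - ε < f (x l)
    have hfx : (1 - δ) * ‖x l‖ < f (x l) := by
      have := hxf.2
      rw [map_smul] at this
      simpa [← div_eq_inv_mul, lt_div_iff₀ hxl] using this
    nlinarith
  · obtain ⟨z, hz, w, hw, hzw⟩ := h (y l)
      ((lp.norm_apply_le_norm ENNReal.top_ne_zero y l).trans hy.le)
    obtain ⟨z', hz', hyz⟩ := exists_mem_glSlice_comp_evalCLM l f hy.le hz
    obtain ⟨w', hw', hyw⟩ := exists_mem_glSlice_comp_evalCLM l f ((norm_neg y).trans hy).le hw
    refine ⟨z', hsub hz', w', hsub hw', ?_⟩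
    have hyw' : ‖y + w'‖ = ‖y l + w‖ := by
      rw [← norm_neg, neg_add', hyw, lp.coeFn_neg, Pi.neg_apply, ← neg_add', norm_neg]
    linarith
end

section
/- Let E and F be real Banach spaces and let T : S_E → S_F be an isometry (distance-preserving map, not necessarily surjective). If E is a GL-space, then ‖T(x) − λ T(y)‖ ≥ ‖x − λ y‖ for all x, y ∈ S_E and all real λ ≥ 0. -/
open Metric Set

/-- If the distances from `x` to the slice of `f` and to its opposite add up to less than `2 + ε`,
then the slice contains a unit vector nearly as close to `x` as `f` permits. -/
theorem exists_norm_one_near_of_infDist_add_lt {E : Type*} [NormedAddCommGroup E]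
    [NormedSpace ℝ E] {f : E →L[ℝ] ℝ} (hf : ‖f‖ = 1) {ε : ℝ} (hε : ε < 1)
    (hne : (glSlice f ε).Nonempty) {x : E}
    (hx : infDist x (glSlice f ε) + infDist x (-(glSlice f ε)) < 2 + ε) :
    ∃ u : E, ‖u‖ = 1 ∧ 1 - ε < f u ∧ ‖x - u‖ < 1 + 3 * ε - f x := by
  have hbound (z : E) : f z ≤ ‖z‖ := by
    simpa [hf] using (le_abs_self _).trans (f.le_opNorm z)
  have hopp : 1 - ε + f x ≤ infDist x (-(glSlice f ε)) := by
    refine (le_infDist hne.neg).2 fun w hw => ?_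
    have hw' : 1 - ε < f (-w) := hw.2
    have h := hbound (x - w)
    rw [map_neg] at hw'
    rw [map_sub] at h
    rw [dist_eq_norm]
    linarith
  obtain ⟨u, ⟨hu1, hfu⟩, hxu⟩ :=
    (infDist_lt_iff (r := 1 + 2 * ε - f x) hne).1 (by linarith)
  rw [dist_eq_norm] at hxu
  have hu : 1 - ε < ‖u‖ := hfu.trans_le (hbound u)
  have hpos : 0 < ‖u‖ := by linarith
  have hinv : 1 ≤ ‖u‖⁻¹ := (one_le_inv₀ hpos).2 hu1
  have hdist : ‖u - ‖u‖⁻¹ • u‖ = 1 - ‖u‖ := by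
    have h : u - ‖u‖⁻¹ • u = (1 - ‖u‖⁻¹) • u := by rw [sub_smul, one_smul]
    rw [h, norm_smul, Real.norm_eq_abs, abs_of_nonpos (by linarith)]
    field_simp
    ring
  refine ⟨‖u‖⁻¹ • u, norm_smul_inv_norm (𝕜 := ℝ) (norm_pos_iff.1 hpos), ?_, ?_⟩
  · rw [map_smul, smul_eq_mul]
    nlinarith
  · have := norm_sub_le_norm_sub_add_norm_sub x u (‖u‖⁻¹ • u)
    linarith

/-- A norm-preserving isometry `T` of unit spheres almost dominates evaluation of `f` on
`x - l • y`, provided `f` has slices close to every unit vector on both sides. -/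
theorem apply_sub_smul_le_norm_of_isometry {E F : Type*} [NormedAddCommGroup E]
    [NormedSpace ℝ E] [NormedAddCommGroup F] [NormedSpace ℝ F] {T : E → F}
    (hmap : ∀ x : E, ‖x‖ = 1 → ‖T x‖ = 1)
    (hiso : ∀ x y : E, ‖x‖ = 1 → ‖y‖ = 1 → ‖T x - T y‖ = ‖x - y‖)
    {f : E →L[ℝ] ℝ} (hf : ‖f‖ = 1) {ε : ℝ}
    (hnear : ∀ x : E, ‖x‖ = 1 →
      ∃ u : E, ‖u‖ = 1 ∧ 1 - ε < f u ∧ ‖x - u‖ < 1 + 3 * ε - f x)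
    {x y : E} (hx : ‖x‖ = 1) (hy : ‖y‖ = 1) {l : ℝ} (hl : 0 ≤ l) :
    f (x - l • y) ≤ ‖T x - l • T y‖ + 5 * ε * (1 + l) := by
  obtain ⟨u, hu, hfu, hxu⟩ := hnear x hx
  obtain ⟨v, hv, hfv, hyv⟩ := hnear (-y) (by rwa [norm_neg])
  have hv' : ‖-v‖ = 1 := by rwa [norm_neg]
  have huv : 2 - 2 * ε < ‖T u - T (-v)‖ := by
    rw [hiso u (-v) hu hv', sub_neg_eq_add]
    have h : f (u + v) ≤ ‖u + v‖ := by
      simpa [hf] using (le_abs_self _).trans (f.le_opNorm (u + v))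
    rw [map_add] at h
    linarith
  obtain ⟨g, hg, hguv⟩ := exists_dual_vector'' ℝ (T u - T (-v))
  have hbound (z : F) : |g z| ≤ ‖z‖ := by
    simpa using g.le_of_opNorm_le hg z
  have hgu := (abs_le.1 (hbound (T u))).2
  have hgv := (abs_le.1 (hbound (T (-v)))).1
  have hgx := (abs_le.1 (hbound (T x - T u))).1
  have hgy := (abs_le.1 (hbound (T y - T (-v)))).2
  have hg' := (abs_le.1 (hbound (T x - l • T y))).2
  have hyv' : ‖y - -v‖ = ‖-y - v‖ := by
    rw [← norm_neg]; congr 1; abel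
  rw [hiso x u hx hu] at hgx
  rw [hiso y (-v) hy hv', hyv'] at hgy
  rw [hmap u hu] at hgu
  rw [hmap (-v) hv'] at hgv
  simp only [map_sub, map_neg, map_smul, smul_eq_mul, RCLike.ofReal_real_eq_id, id] at *
  have hlow : f x - 5 * ε ≤ g (T x) := by linarith
  have hupp : g (T y) ≤ f y + 5 * ε := by linarith
  nlinarith [mul_le_mul_of_nonneg_left hupp hl]

/-- Proposition 3.1: if `E` is a GL-space and `T : S_E → S_F` is an isometry (not
necessarily surjective), then `‖T x - λ • T y‖ ≥ ‖x - λ • y‖` for all `x, y ∈ S_E` and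
all `λ ≥ 0`. -/
theorem stmt_11 {E F : Type*} [NormedAddCommGroup E] [NormedSpace ℝ E] [CompleteSpace E]
    [NormedAddCommGroup F] [NormedSpace ℝ F] [CompleteSpace F]
    (hE : IsGLSpace E) (T : E → F)
    (hmap : ∀ x : E, ‖x‖ = 1 → ‖T x‖ = 1)
    (hiso : ∀ x y : E, ‖x‖ = 1 → ‖y‖ = 1 → ‖T x - T y‖ = ‖x - y‖) :
    ∀ x y : E, ‖x‖ = 1 → ‖y‖ = 1 → ∀ l : ℝ, 0 ≤ l →
      ‖x - l • y‖ ≤ ‖T x - l • T y‖ := by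
  intro x y hx hy l hl
  rcases eq_or_ne (x - l • y) 0 with hz | hz
  · rw [hz, norm_zero]
    exact norm_nonneg _
  have hzpos : 0 < ‖x - l • y‖ := norm_pos_iff.2 hz
  set C : ℝ := ‖x - l • y‖ + 5 * (1 + l) with hC
  have hCpos : 0 < C := by positivity
  refine le_of_forall_pos_le_add fun δ hδ => ?_
  obtain ⟨ε, hε, hεlt⟩ : ∃ ε : ℝ, 0 < ε ∧ ε < min 1 (δ / C) :=
    exists_between (lt_min one_pos (div_pos hδ hCpos))
  have hεC : ε * C < δ := (lt_div_iff₀ hCpos).1 (hεlt.trans_le (min_le_right _ _))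
  obtain ⟨f, hf, hfz, hdist⟩ :=
    hE (‖x - l • y‖⁻¹ • (x - l • y)) (norm_smul_inv_norm (𝕜 := ℝ) hz) ε hε
  have hnorm : (1 - ε) * ‖x - l • y‖ < f (x - l • y) := by
    have h := hfz.2
    rwa [map_smul, smul_eq_mul, inv_mul_eq_div, lt_div_iff₀ hzpos] at h
  have hmain := apply_sub_smul_le_norm_of_isometry hmap hiso hf
    (fun w hw => exists_norm_one_near_of_infDist_add_lt hf
      (hεlt.trans_le (min_le_left _ _)) ⟨_, hfz⟩ (hdist w hw)) hx hy hl
  rw [hC] at hεC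
  linarith
end

section
/- Every real GL-space E has the Mazur–Ulam property: for every real Banach space F, every surjective isometry T : S_E → S_F is the restriction to S_E of a surjective linear isometry from E onto F. -/
open Metric Set

section SphereIsometry

variable {E F : Type*} [NormedAddCommGroup E] [NormedSpace ℝ E]
  [NormedAddCommGroup F] [NormedSpace ℝ F]

theorem norm_inv_smul_eq_one {x : E} (hx : x ≠ 0) : ‖‖x‖⁻¹ • x‖ = 1 :=
  norm_smul_inv_norm (𝕜 := ℝ) hx

theorem norm_sub_inv_smul {x : E} (hx : x ≠ 0) : ‖x - ‖x‖⁻¹ • x‖ = |‖x‖ - 1| := by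
  have h : x - ‖x‖⁻¹ • x = (‖x‖ - 1) • (‖x‖⁻¹ • x) := by
    rw [sub_smul, one_smul, smul_inv_smul₀ (norm_ne_zero_iff.2 hx)]
  rw [h, norm_smul, norm_inv_smul_eq_one hx, mul_one, Real.norm_eq_abs]

theorem apply_le_norm {f : E →L[ℝ] ℝ} (hf : ‖f‖ ≤ 1) (x : E) : f x ≤ ‖x‖ :=
  (le_abs_self _).trans ((f.le_of_opNorm_le hf x).trans_eq (one_mul _))

theorem neg_apply_le_norm {f : E →L[ℝ] ℝ} (hf : ‖f‖ ≤ 1) (x : E) : -f x ≤ ‖x‖ := by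
  simpa using apply_le_norm hf (-x)

theorem le_apply_inv_smul {f : E →L[ℝ] ℝ} {x : E} (hx : x ≠ 0) (hx1 : ‖x‖ ≤ 1) (h : 0 ≤ f x) :
    f x ≤ f (‖x‖⁻¹ • x) := by
  rw [map_smul, smul_eq_mul]
  exact le_mul_of_one_le_left h ((one_le_inv₀ (norm_pos_iff.2 hx)).2 hx1)

/-- A convex set of vectors of norm at least `r` lies in a half-space `{x | r ≤ g x}` with
`‖g‖ ≤ 1`. -/
theorem exists_norm_le_one_forall_le_of_convex {C : Set F} (hC : Convex ℝ C) (hne : C.Nonempty)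
    {r : ℝ} (hr : 0 < r) (h : ∀ x ∈ C, r ≤ ‖x‖) :
    ∃ g : F →L[ℝ] ℝ, ‖g‖ ≤ 1 ∧ ∀ x ∈ C, r ≤ g x := by
  obtain ⟨φ, u, hφ, hu⟩ := geometric_hahn_banach_open (convex_ball (0 : F) r) isOpen_ball hC
    (Set.disjoint_left.2 fun x hx hxC => by
      rw [mem_ball_zero_iff] at hx
      exact (h x hxC).not_gt hx)
  have hu0 : 0 < u := by simpa using hφ 0 (mem_ball_self hr)
  obtain ⟨c, hc⟩ := hne
  have hφ0 : 0 < ‖φ‖ := norm_pos_iff.2 fun h0 => by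
    have := hu c hc
    simp only [h0, zero_apply] at this
    linarith
  have hle : ∀ z ∈ closedBall (0 : F) r, φ z ≤ u := by
    rw [← closure_ball (0 : F) hr.ne']
    exact fun z hz => closure_minimal (fun x hx => (hφ x hx).le)
      (isClosed_le φ.continuous continuous_const) hz
  have hbound : ‖φ‖ ≤ u / r :=
    ContinuousLinearMap.opNorm_bound_of_ball_bound hr u φ fun z hz => by
      rw [Real.norm_eq_abs, abs_le]
      have := hle (-z) (by simpa using hz)
      rw [map_neg] at this
      exact ⟨by linarith, hle z hz⟩
  refine ⟨‖φ‖⁻¹ • φ, (norm_inv_smul_eq_one (norm_pos_iff.1 hφ0)).le, fun x hx => ?_⟩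
  have hx := hu x hx
  rw [le_div_iff₀ hr] at hbound
  rw [smul_apply, smul_eq_mul, ← div_eq_inv_mul, le_div_iff₀ hφ0]
  linarith

/-- If a slice of the unit ball of `F` contains `T x₀`, and `y` is almost aligned with every unit
vector which is almost aligned with `x₀`, then some slightly larger slice contains both the given
slice and `T y`. -/
theorem exists_larger_slice {X : Type*} [NormedAddCommGroup X] {T T' : X → F}
    (hmap : ∀ x, ‖x‖ = 1 → ‖T x‖ = 1)
    (hsurj : ∀ z : F, ‖z‖ = 1 → ∃ x : X, ‖x‖ = 1 ∧ T' x = z)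
    (hadd : ∀ a b, ‖a‖ = 1 → ‖b‖ = 1 → ‖T a + T' b‖ = ‖a + b‖)
    {x₀ y : X} (hx₀ : ‖x₀‖ = 1) (hy : ‖y‖ = 1) {N δ : ℝ} (hN : 0 ≤ N) (hδ : 0 ≤ δ)
    (H : ∀ e t, ‖e‖ = 1 → 2 - t ≤ ‖e + x₀‖ → 2 - N * t - δ ≤ ‖e + y‖)
    {f : F →L[ℝ] ℝ} (hf : ‖f‖ ≤ 1) (hfx : 1 - δ ≤ f (T x₀)) :
    ∃ g : F →L[ℝ] ℝ, ‖g‖ ≤ 1 ∧ 1 - (2 * N + 2) * δ ≤ g (T y) ∧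
      ∀ d, ‖d‖ ≤ 1 → 1 - δ ≤ f d → 1 - (2 * N + 2) * δ ≤ g d := by
  rcases le_or_gt 2 ((2 * N + 2) * δ) with hbig | hsmall
  · refine ⟨f, hf, ?_, fun d hd _ => ?_⟩
    · have := neg_apply_le_norm hf (T y)
      rw [hmap y hy] at this
      linarith
    · have := neg_apply_le_norm hf d
      linarith
  have hNδ : 0 ≤ N * δ := mul_nonneg hN hδ
  have hδ1 : δ < 1 := by linarith
  let K : Set F := {d | ‖d‖ ≤ 1 ∧ 1 - δ ≤ f d}
  have hK : Convex ℝ K := by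
    have h1 : Convex ℝ {d : F | ‖d‖ ≤ 1} := by
      simpa [closedBall, dist_zero_right] using convex_closedBall (0 : F) 1
    exact h1.inter (convex_halfSpace_ge f.toLinearMap.isLinear _)
  have hKx : T x₀ ∈ K := ⟨(hmap x₀ hx₀).le, hfx⟩
  obtain ⟨g, hg, hgK⟩ := exists_norm_le_one_forall_le_of_convex (hK.translate (T y))
    ⟨_, mem_image_of_mem _ hKx⟩ (r := 2 - (2 * N + 2) * δ) (by linarith) (by
      rintro _ ⟨d, ⟨hd1, hfd⟩, rfl⟩
      have hdn : 1 - δ ≤ ‖d‖ := hfd.trans (apply_le_norm hf d)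
      have hd0 : d ≠ 0 := norm_pos_iff.1 (by linarith)
      have hfd' := le_apply_inv_smul (f := f) hd0 hd1 (by linarith)
      obtain ⟨e, he, hed⟩ := hsurj _ (norm_inv_smul_eq_one hd0)
      have h1 : 2 - 2 * δ ≤ ‖e + x₀‖ := by
        rw [add_comm, ← hadd x₀ e hx₀ he, hed]
        refine le_trans ?_ (apply_le_norm hf _)
        rw [map_add]
        linarith
      have h2 := H e _ he h1
      rw [add_comm, ← hadd y e hy he, hed] at h2
      have h3 : ‖T y + ‖d‖⁻¹ • d‖ ≤ ‖T y + d‖ + ‖d - ‖d‖⁻¹ • d‖ := by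
        have : T y + ‖d‖⁻¹ • d = (T y + d) - (d - ‖d‖⁻¹ • d) := by abel
        rw [this]
        exact norm_sub_le _ _
      rw [norm_sub_inv_smul hd0, abs_of_nonpos (by linarith)] at h3
      show _ ≤ ‖T y + d‖
      linarith)
  have hgK' : ∀ d ∈ K, 2 - (2 * N + 2) * δ ≤ g (T y) + g d := fun d hd => by
    simpa using hgK _ (mem_image_of_mem _ hd)
  refine ⟨g, hg, ?_, fun d hd hfd => ?_⟩
  · have h1 := hgK' _ hKx
    have h2 := apply_le_norm hg (T x₀)
    rw [hmap x₀ hx₀] at h2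
    linarith
  · have h1 := hgK' d ⟨hd, hfd⟩
    have h2 := apply_le_norm hg (T y)
    rw [hmap y hy] at h2
    linarith

/-- Finitely many unit vectors of a slice have a common approximate centre `x₀`: any unit vector
almost aligned with `x₀` is almost aligned with each of them. -/
theorem exists_approximate_centre {ι : Type*} [Fintype ι] [Nonempty ι] {y : ι → E}
    (hy : ∀ i, ‖y i‖ = 1) {f : E →L[ℝ] ℝ} (hf : ‖f‖ ≤ 1) {ε : ℝ} (hε1 : ε < 1)
    (hfy : ∀ i, 1 - ε ≤ f (y i)) :
    ∃ x₀ : E, ‖x₀‖ = 1 ∧ ∀ i e t, ‖e‖ = 1 → 2 - t ≤ ‖e + x₀‖ →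
      2 - (Fintype.card ι + 1) * t - Fintype.card ι * ε ≤ ‖e + y i‖ := by
  set n : ℝ := (Fintype.card ι : ℝ)
  have hn : 0 < n := Nat.cast_pos.2 Fintype.card_pos
  set a : E := n⁻¹ • ∑ i, y i with ha
  have hna : n • a = ∑ i, y i := smul_inv_smul₀ hn.ne' _
  have ha1 : ‖a‖ ≤ 1 := by
    have h1 : ‖∑ i, y i‖ ≤ n := (norm_sum_le _ _).trans_eq (by simp [hy, n])
    rw [ha, norm_smul, norm_inv, Real.norm_of_nonneg hn.le, ← div_eq_inv_mul]
    exact (div_le_one hn).2 h1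
  have hfa : 1 - ε ≤ f a := by
    have h1 : n * (1 - ε) ≤ n * f a := by
      have h2 := Finset.sum_le_sum (s := Finset.univ) fun i _ => hfy i
      rw [← map_sum, ← hna, map_smul, smul_eq_mul] at h2
      rwa [Finset.sum_const, Finset.card_univ, nsmul_eq_mul] at h2
    exact le_of_mul_le_mul_left h1 hn
  have hna1 : 1 - ε ≤ ‖a‖ := hfa.trans (apply_le_norm hf a)
  have ha0 : a ≠ 0 := norm_pos_iff.1 (by linarith)
  refine ⟨‖a‖⁻¹ • a, norm_inv_smul_eq_one ha0, fun i e t he het => ?_⟩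
  obtain ⟨g, hg, hge⟩ := exists_dual_vector'' ℝ (e + ‖a‖⁻¹ • a)
  simp only [RCLike.ofReal_real_eq_id, id_eq, map_add] at hge
  have h1 := apply_le_norm hg e
  have h2 := apply_le_norm hg (‖a‖⁻¹ • a)
  rw [norm_inv_smul_eq_one ha0] at h2
  have h3 := neg_apply_le_norm hg (a - ‖a‖⁻¹ • a)
  rw [norm_sub_inv_smul ha0, abs_of_nonpos (by linarith), map_sub] at h3
  have h4 : 1 - t - ε ≤ g a := by linarith
  have h5 : n * g a ≤ g (y i) + (n - 1) := by
    classical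
    have h6 : n * g a = ∑ j, g (y j) := by
      rw [← map_sum, ← hna]
      exact (g.map_smul n a).symm
    have h7 : ∑ j ∈ Finset.univ.erase i, g (y j) ≤ ∑ j ∈ Finset.univ.erase i, (1 : ℝ) :=
      Finset.sum_le_sum fun j _ => (apply_le_norm hg _).trans_eq (hy j)
    have h8 : ∑ j ∈ Finset.univ.erase i, (1 : ℝ) = n - 1 := by
      rw [Finset.sum_erase_eq_sub (Finset.mem_univ i)]
      simp [n]
    rw [h6, ← Finset.add_sum_erase _ _ (Finset.mem_univ i)]
    linarith
  have h9 := mul_le_mul_of_nonneg_left h4 hn.le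
  have h10 := apply_le_norm hg (e + y i)
  rw [map_add] at h10
  linarith

/-- Images of finitely many unit vectors of a slice, and the negatives of the images of their
opposites, lie in a common slice. -/
theorem exists_slice_image {T : E → F} (hmap : ∀ x : E, ‖x‖ = 1 → ‖T x‖ = 1)
    (hsurj : ∀ z : F, ‖z‖ = 1 → ∃ x : E, ‖x‖ = 1 ∧ T x = z)
    (hiso : ∀ x y : E, ‖x‖ = 1 → ‖y‖ = 1 → ‖T x - T y‖ = ‖x - y‖)
    (ι : Type*) [Fintype ι] [Nonempty ι] :
    ∃ C : ℝ, 0 ≤ C ∧ ∀ (y : ι → E) (f : E →L[ℝ] ℝ) (ε : ℝ), (∀ i, ‖y i‖ = 1) → ‖f‖ ≤ 1 →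
      0 ≤ ε → ε < 1 → (∀ i, 1 - ε ≤ f (y i)) →
      ∃ g : F →L[ℝ] ℝ, ‖g‖ ≤ 1 ∧ ∀ i, 1 - C * ε ≤ g (T (y i)) ∧ g (T (-y i)) ≤ -1 + C * ε := by
  classical
  set n : ℝ := (Fintype.card ι : ℝ) with hn_def
  have hn : 0 ≤ n := Nat.cast_nonneg _
  set M : ℝ := 2 * (n + 1) + 2 with hM_def
  have hM : 1 ≤ M := by linarith
  refine ⟨(M * M) ^ Fintype.card ι * n, by positivity, fun y f ε hy hf hε hε1 hfy => ?_⟩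
  obtain ⟨x₀, hx₀, H⟩ := exists_approximate_centre hy hf hε1 hfy
  rw [← hn_def] at H
  have hmap' : ∀ x : E, ‖x‖ = 1 → ‖-T (-x)‖ = 1 := fun x hx => by
    rw [norm_neg, hmap _ (by rwa [norm_neg])]
  have hsurj' : ∀ z : F, ‖z‖ = 1 → ∃ x : E, ‖x‖ = 1 ∧ -T (-x) = z := fun z hz => by
    obtain ⟨x, hx, hxz⟩ := hsurj (-z) (by rwa [norm_neg])
    exact ⟨-x, by rwa [norm_neg], by rw [neg_neg, hxz, neg_neg]⟩
  have hadd : ∀ a b, ‖a‖ = 1 → ‖b‖ = 1 → ‖T a + -T (-b)‖ = ‖a + b‖ := fun a b ha hb => by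
    rw [← sub_eq_add_neg, hiso a _ ha (by rwa [norm_neg]), sub_neg_eq_add]
  have hadd' : ∀ a b, ‖a‖ = 1 → ‖b‖ = 1 → ‖-T (-a) + T b‖ = ‖a + b‖ := fun a b ha hb => by
    rw [add_comm, hadd b a hb ha, add_comm]
  have key : ∀ s : Finset ι, ∃ g : F →L[ℝ] ℝ, ‖g‖ ≤ 1 ∧
      1 - (M * M) ^ s.card * (n * ε) ≤ g (T x₀) ∧
      1 - (M * M) ^ s.card * (n * ε) ≤ g (-T (-x₀)) ∧
      ∀ i ∈ s, 1 - (M * M) ^ s.card * (n * ε) ≤ g (T (y i)) ∧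
        1 - (M * M) ^ s.card * (n * ε) ≤ g (-T (-y i)) := by
    intro s
    induction s using Finset.induction_on with
    | empty =>
      obtain ⟨g, hg, hge⟩ := exists_dual_vector'' ℝ (T x₀ + -T (-x₀))
      rw [hadd x₀ x₀ hx₀ hx₀, ← two_smul ℝ x₀, norm_smul, hx₀] at hge
      simp only [map_add, Real.norm_ofNat, RCLike.ofReal_real_eq_id, id_eq] at hge
      have h1 := apply_le_norm hg (T x₀)
      have h2 := apply_le_norm hg (-T (-x₀))
      rw [hmap x₀ hx₀] at h1
      rw [hmap' x₀ hx₀] at h2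
      have h3 : 0 ≤ n * ε := by positivity
      refine ⟨g, hg, ?_, ?_, by simp⟩ <;> simp only [Finset.card_empty, pow_zero] <;> linarith
    | insert i s his ih =>
      obtain ⟨g, hg, hgx, hgx', hgs⟩ := ih
      rw [Finset.card_insert_of_notMem his]
      set δ := (M * M) ^ s.card * (n * ε)
      have hnε : n * ε ≤ δ := le_mul_of_one_le_left (by positivity)
        (one_le_pow₀ (one_le_mul_of_one_le_of_one_le hM hM))
      have hδ : 0 ≤ δ := (by positivity : 0 ≤ n * ε).trans hnε
      have hδM : δ ≤ M * δ := le_mul_of_one_le_left hδ hM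
      have hpow : (M * M) ^ (s.card + 1) * (n * ε) = M * (M * δ) := by
        rw [pow_succ]; ring
      rw [hpow]
      obtain ⟨g₁, hg₁, hg₁y, hg₁K⟩ := exists_larger_slice hmap hsurj' hadd hx₀ (hy i)
        (N := n + 1) (by positivity) hδ
        (fun e t he het => by linarith [H i e t he het]) hg hgx
      obtain ⟨g₂, hg₂, hg₂y, hg₂K⟩ := exists_larger_slice (T := fun x => -T (-x)) hmap' hsurj
        hadd' hx₀ (hy i) (N := n + 1) (δ := M * δ) (by positivity) (by positivity)
        (fun e t he het => by linarith [H i e t he het]) hg₁ (hg₁K _ (hmap' _ hx₀).le hgx')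
      have hK : ∀ d, ‖d‖ ≤ 1 → 1 - δ ≤ g d → 1 - M * (M * δ) ≤ g₂ d :=
        fun d hd h => hg₂K d hd (hg₁K d hd h)
      refine ⟨g₂, hg₂, hK _ (hmap _ hx₀).le hgx, hK _ (hmap' _ hx₀).le hgx', fun j hj => ?_⟩
      rcases Finset.mem_insert.1 hj with rfl | hj
      · exact ⟨hg₂K _ (hmap _ (hy j)).le hg₁y, hg₂y⟩
      · exact ⟨hK _ (hmap _ (hy j)).le (hgs j hj).1, hK _ (hmap' _ (hy j)).le (hgs j hj).2⟩
  obtain ⟨g, hg, -, -, hgy⟩ := key Finset.univ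
  refine ⟨g, hg, fun i => ?_⟩
  obtain ⟨h1, h2⟩ := hgy i (Finset.mem_univ i)
  rw [Finset.card_univ, ← mul_assoc] at h1 h2
  rw [map_neg] at h2
  exact ⟨h1, by linarith⟩

theorem exists_unit_mem_slice_norm_sub_le {f : E →L[ℝ] ℝ} (hf : ‖f‖ = 1) {ε : ℝ} (hε1 : ε < 1)
    (hne : (glSlice f ε).Nonempty) {y : E}
    (h : infDist y (glSlice f ε) + infDist y (-(glSlice f ε)) < 2 + ε) :
    ∃ a b : E, ‖a‖ = 1 ∧ ‖b‖ = 1 ∧ 1 - ε ≤ f a ∧ 1 - ε ≤ f b ∧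
      ‖y - a‖ ≤ 1 - f y + 4 * ε ∧ ‖y + b‖ ≤ 1 + f y + 4 * ε := by
  have hunit : ∀ a ∈ glSlice f ε, ‖‖a‖⁻¹ • a‖ = 1 ∧ 1 - ε ≤ f (‖a‖⁻¹ • a) ∧
      ‖a - ‖a‖⁻¹ • a‖ ≤ ε := by
    rintro a ⟨ha1, hfa⟩
    have h1 := apply_le_norm hf.le a
    have ha0 : a ≠ 0 := norm_pos_iff.1 (by linarith)
    refine ⟨norm_inv_smul_eq_one ha0, hfa.le.trans (le_apply_inv_smul ha0 ha1 (by linarith)), ?_⟩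
    rw [norm_sub_inv_smul ha0, abs_of_nonpos (by linarith)]
    linarith
  set η := (2 + ε - (infDist y (glSlice f ε) + infDist y (-(glSlice f ε)))) / 2 with hη
  have hη0 : 0 < η := by linarith
  obtain ⟨a, ha, hya⟩ := (infDist_lt_iff hne).1 (lt_add_of_pos_right (infDist y (glSlice f ε)) hη0)
  obtain ⟨b, hb, hyb⟩ := (infDist_lt_iff hne.neg).1
    (lt_add_of_pos_right (infDist y (-(glSlice f ε))) hη0)
  rw [dist_eq_norm] at hya hyb
  obtain ⟨ha1, hfa, hda⟩ := hunit a ha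
  obtain ⟨hb1, hfb, hdb⟩ := hunit (-b) hb
  set a' := ‖a‖⁻¹ • a
  set b' := ‖-b‖⁻¹ • -b
  have h1 : ‖y - a'‖ ≤ ‖y - a‖ + ε :=
    (norm_sub_le_norm_sub_add_norm_sub y a a').trans (by linarith)
  have h2 : ‖y + b'‖ ≤ ‖y - b‖ + ε := by
    have h3 : y + b' = (y - b) - (-b - b') := by abel
    rw [h3]
    exact (norm_sub_le _ _).trans (by linarith)
  have h3 := neg_apply_le_norm hf.le (y - a')
  have h4 := apply_le_norm hf.le (y + b')
  rw [map_sub] at h3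
  rw [map_add] at h4
  exact ⟨a', b', ha1, hb1, hfa, hfb, by linarith, by linarith⟩

/-- On a GL-space, almost norming functionals are approximately transported by surjective
isometries of unit spheres, uniformly on finite sets. -/
theorem IsGLSpace.exists_approx_transport (hE : IsGLSpace E) {T : E → F}
    (hmap : ∀ x : E, ‖x‖ = 1 → ‖T x‖ = 1)
    (hsurj : ∀ z : F, ‖z‖ = 1 → ∃ x : E, ‖x‖ = 1 ∧ T x = z)
    (hiso : ∀ x y : E, ‖x‖ = 1 → ‖y‖ = 1 → ‖T x - T y‖ = ‖x - y‖)
    {κ : Type*} [Fintype κ] [Nonempty κ] {y : κ → E} (hy : ∀ k, ‖y k‖ = 1)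
    {x : E} (hx : ‖x‖ = 1) {η : ℝ} (hη : 0 < η) :
    ∃ (f : E →L[ℝ] ℝ) (g : F →L[ℝ] ℝ), 1 - η < f x ∧ ∀ k, |g (T (y k)) - f (y k)| ≤ η := by
  obtain ⟨C, hC, hslice⟩ := exists_slice_image hmap hsurj hiso (κ ⊕ κ)
  obtain ⟨ε, hε, hε1, hεη⟩ : ∃ ε : ℝ, 0 < ε ∧ ε < 1 ∧ (4 + C) * ε ≤ η := by
    refine ⟨min (1 / 2) (η / (4 + C)), by positivity, ?_, ?_⟩
    · exact (min_le_left _ _).trans_lt (by norm_num)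
    · rw [mul_comm]
      exact (le_div_iff₀ (by positivity)).1 (min_le_right _ _)
  obtain ⟨f, hf, hxf, hdist⟩ := hE x hx ε hε
  choose a b ha hb hfa hfb hya hyb using fun k =>
    exists_unit_mem_slice_norm_sub_le hf hε1 ⟨x, hxf⟩ (hdist (y k) (hy k))
  obtain ⟨g, hg, hgab⟩ := hslice (Sum.elim a b) f ε (by simp [ha, hb]) hf.le hε.le hε1
    (Sum.rec hfa hfb)
  have hCε : 0 ≤ C * ε := by positivity
  refine ⟨f, g, by linarith [hxf.2], fun k => ?_⟩
  have h1 := (hgab (Sum.inl k)).1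
  have h2 := (hgab (Sum.inr k)).2
  simp only [Sum.elim_inl, Sum.elim_inr] at h1 h2
  have h3 := neg_apply_le_norm hg (T (y k) - T (a k))
  have h4 := apply_le_norm hg (T (y k) - T (-b k))
  rw [hiso _ _ (hy k) (ha k), map_sub] at h3
  rw [hiso _ _ (hy k) (by rw [norm_neg, hb k]), map_sub, sub_neg_eq_add] at h4
  have h5 := hya k
  have h6 := hyb k
  rw [abs_le]
  constructor <;> linarith

/-- The positively homogeneous extension of a map defined on the unit sphere. -/
noncomputable def homogeneousExtension (T : E → F) (x : E) : F :=
  ‖x‖ • T (‖x‖⁻¹ • x)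

theorem homogeneousExtension_smul (T : E → F) {x : E} (hx : ‖x‖ = 1) {r : ℝ} (hr : 0 ≤ r) :
    homogeneousExtension T (r • x) = r • T x := by
  rcases hr.eq_or_lt with rfl | hr
  · simp [homogeneousExtension]
  · have h : ‖r • x‖ = r := by rw [norm_smul, hx, mul_one, Real.norm_of_nonneg hr.le]
    rw [homogeneousExtension, h, inv_smul_smul₀ hr.ne']

theorem norm_homogeneousExtension {T : E → F} (hmap : ∀ x : E, ‖x‖ = 1 → ‖T x‖ = 1) (x : E) :
    ‖homogeneousExtension T x‖ = ‖x‖ := by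
  rcases eq_or_ne x 0 with rfl | hx
  · simp [homogeneousExtension]
  · rw [homogeneousExtension, norm_smul, norm_norm, hmap _ (norm_inv_smul_eq_one hx), mul_one]

theorem surjective_homogeneousExtension {T : E → F}
    (hsurj : ∀ z : F, ‖z‖ = 1 → ∃ x : E, ‖x‖ = 1 ∧ T x = z) :
    Function.Surjective (homogeneousExtension T) := by
  intro z
  rcases eq_or_ne z 0 with rfl | hz
  · exact ⟨0, by simp [homogeneousExtension]⟩
  · obtain ⟨x, hx, hxz⟩ := hsurj _ (norm_inv_smul_eq_one hz)
    exact ⟨‖z‖ • x, by rw [homogeneousExtension_smul T hx (norm_nonneg z), hxz,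
      smul_inv_smul₀ (norm_ne_zero_iff.2 hz)]⟩

theorem IsGLSpace.homogeneousExtension_add (hE : IsGLSpace E) {T : E → F}
    (hmap : ∀ x : E, ‖x‖ = 1 → ‖T x‖ = 1)
    (hsurj : ∀ z : F, ‖z‖ = 1 → ∃ x : E, ‖x‖ = 1 ∧ T x = z)
    (hiso : ∀ x y : E, ‖x‖ = 1 → ‖y‖ = 1 → ‖T x - T y‖ = ‖x - y‖) (u v : E) :
    homogeneousExtension T (u + v) = homogeneousExtension T u + homogeneousExtension T v := by
  obtain ⟨w, hw⟩ := surjective_homogeneousExtension hsurj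
    (homogeneousExtension T u + homogeneousExtension T v)
  suffices h : u + v = w by rw [h, hw]
  by_contra hne
  set z := u + v - w with hz
  have hz0 : z ≠ 0 := sub_ne_zero.2 hne
  have hzpos : 0 < ‖z‖ := norm_pos_iff.2 hz0
  have hdir : ∀ p : E, ∃ q : E, ‖q‖ = 1 ∧ ‖p‖ • q = p := fun p => by
    rcases eq_or_ne p 0 with rfl | hp
    · exact ⟨‖z‖⁻¹ • z, norm_inv_smul_eq_one hz0, by simp⟩
    · exact ⟨‖p‖⁻¹ • p, norm_inv_smul_eq_one hp, smul_inv_smul₀ (norm_ne_zero_iff.2 hp) _⟩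
  choose q hq1 hq using hdir
  set s := ‖u‖ + ‖v‖ + ‖w‖
  have hs : 0 ≤ s := by positivity
  set η := ‖z‖ / (‖z‖ + s + 1) with hη_def
  have hη : 0 < η := by positivity
  have hηmul : η * (‖z‖ + s + 1) = ‖z‖ := div_mul_cancel₀ _ (by positivity)
  obtain ⟨f, g, hfz, hfg⟩ := hE.exists_approx_transport hmap hsurj hiso
    (y := fun k => q (![u, v, w] k)) (fun k => hq1 _) (norm_inv_smul_eq_one hz0) hη
  have happrox : ∀ p, |g (T (q p)) - f (q p)| ≤ η →
      |g (homogeneousExtension T p) - f p| ≤ η * ‖p‖ := fun p hp => by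
    have h1 : homogeneousExtension T p = ‖p‖ • T (q p) := by
      conv_lhs => rw [← hq p]
      exact homogeneousExtension_smul T (hq1 p) (norm_nonneg p)
    have h2 : f p = ‖p‖ * f (q p) := by
      conv_lhs => rw [← hq p]
      rw [map_smul, smul_eq_mul]
    rw [h1, h2, map_smul, smul_eq_mul, ← mul_sub, abs_mul, abs_norm, mul_comm]
    exact mul_le_mul_of_nonneg_right hp (norm_nonneg p)
  have hu := abs_le.1 (happrox u (hfg 0))
  have hv := abs_le.1 (happrox v (hfg 1))
  have hw' := abs_le.1 (happrox w (hfg 2))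
  have hgw : g (homogeneousExtension T w) =
      g (homogeneousExtension T u) + g (homogeneousExtension T v) := by rw [hw, map_add]
  have hfz' : (1 - η) * ‖z‖ < f z := by
    rw [map_smul, smul_eq_mul, ← div_eq_inv_mul, lt_div_iff₀ hzpos] at hfz
    exact hfz
  have hfz'' : f z = f u + f v - f w := by rw [hz, map_sub, map_add]
  have hsum : f z ≤ η * s := by
    simp only [s, mul_add]
    linarith [hu.1, hv.1, hw'.2]
  linarith

end SphereIsometry

/-- Theorem 3.2: every GL-space has the Mazur–Ulam property: for every Banach space `F`,
every surjective isometry `T : S_E → S_F` extends to a surjective linear isometry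
`E ≃ F`. -/
theorem stmt_12 {E F : Type*} [NormedAddCommGroup E] [NormedSpace ℝ E] [CompleteSpace E]
    [NormedAddCommGroup F] [NormedSpace ℝ F] [CompleteSpace F]
    (hE : IsGLSpace E) (T : E → F)
    (hmap : ∀ x : E, ‖x‖ = 1 → ‖T x‖ = 1)
    (hsurj : ∀ z : F, ‖z‖ = 1 → ∃ x : E, ‖x‖ = 1 ∧ T x = z)
    (hiso : ∀ x y : E, ‖x‖ = 1 → ‖y‖ = 1 → ‖T x - T y‖ = ‖x - y‖) :
    ∃ L : E ≃ₗᵢ[ℝ] F, ∀ x : E, ‖x‖ = 1 → L x = T x := by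
  let V : E →+ F := AddMonoidHom.mk' (homogeneousExtension T)
    (hE.homogeneousExtension_add hmap hsurj hiso)
  have hnorm : ∀ x, ‖V x‖ = ‖x‖ := norm_homogeneousExtension hmap
  let L : E →ₗᵢ[ℝ] F :=
    ⟨(V.toRealLinearMap (AddMonoidHomClass.isometry_of_norm V hnorm).continuous).toLinearMap, hnorm⟩
  refine ⟨LinearIsometryEquiv.ofSurjective L (surjective_homogeneousExtension hsurj),
    fun x hx => ?_⟩
  have h := homogeneousExtension_smul T hx zero_le_one
  rwa [one_smul, one_smul] at h
end

section
/- Let E and F be real Banach spaces and let T : S_E → S_F be a surjective isometry satisfying ‖T(x) − λ T(y)‖ ≥ ‖x − λ y‖ for all x, y ∈ S_E and all real λ ≥ 0. Then T is the restriction to S_E of a surjective linear isometry from E onto F; in particular the positively homogeneous extension x ↦ ‖x‖ T(x/‖x‖) (with 0 ↦ 0) is a surjective linear isometry. -/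
open Metric Set

/-- On every ray leaving a point `u` through a point `v` of strictly smaller norm there is
a point beyond `v` at which the norm is again `‖u‖`. -/
lemma exists_norm_eq_of_norm_lt {F : Type*} [NormedAddCommGroup F] [NormedSpace ℝ F]
    {u v : F} (h : ‖v‖ < ‖u‖) : ∃ s : ℝ, 1 ≤ s ∧ ‖u + s • (v - u)‖ = ‖u‖ := by
  have hd : 0 < ‖v - u‖ := by
    rw [norm_pos_iff, sub_ne_zero]
    rintro rfl
    exact lt_irrefl _ h
  set M : ℝ := 1 + 2 * ‖u‖ / ‖v - u‖
  have hM : 1 ≤ M := le_add_of_nonneg_right (by positivity)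
  have hMu : ‖u‖ ≤ ‖u + M • (v - u)‖ := by
    have h1 : ‖M • (v - u)‖ - ‖u‖ ≤ ‖u + M • (v - u)‖ := by
      simpa using norm_sub_norm_le (M • (v - u)) (-u) |>.trans_eq (by rw [sub_neg_eq_add, add_comm])
    have h2 : ‖M • (v - u)‖ = ‖v - u‖ + 2 * ‖u‖ := by
      rw [norm_smul, Real.norm_of_nonneg (by linarith)]
      simp only [M]
      field_simp
    linarith
  have hc : ContinuousOn (fun s : ℝ => ‖u + s • (v - u)‖) (Icc 1 M) := by fun_prop
  obtain ⟨s, hs, hsu⟩ := intermediate_value_Icc hM hc ⟨by simpa using h.le, hMu⟩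
  exact ⟨s, hs.1, hsu⟩

/-- A surjective, norm-preserving, expansive map between normed spaces that is isometric on
every sphere centred at the origin is an isometry. -/
lemma isometry_of_expansive_of_isometric_on_spheres {E F : Type*}
    [NormedAddCommGroup E] [NormedAddCommGroup F] [NormedSpace ℝ F] {H : E → F}
    (hnorm : ∀ x, ‖H x‖ = ‖x‖) (hsurj : Function.Surjective H)
    (hexp : ∀ x y, ‖x - y‖ ≤ ‖H x - H y‖)
    (hiso : ∀ x y, ‖x‖ = ‖y‖ → ‖H x - H y‖ = ‖x - y‖) : Isometry H := by
  have key : ∀ x y, ‖y‖ < ‖x‖ → ‖H x - H y‖ = ‖x - y‖ := by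
    intro x y hxy
    obtain ⟨s, hs, hsu⟩ := exists_norm_eq_of_norm_lt (u := H x) (v := H y) (by simpa [hnorm])
    obtain ⟨w, hw⟩ := hsurj (H x + s • (H y - H x))
    have hxw := hiso x w (by rw [← hnorm x, ← hnorm w, hw, hsu])
    have h1 : ‖H x - H w‖ = s * ‖H x - H y‖ := by
      rw [hw, sub_add_cancel_left, norm_neg, norm_smul, Real.norm_of_nonneg (by linarith),
        norm_sub_rev]
    have h2 : ‖H y - H w‖ = (s - 1) * ‖H x - H y‖ := by
      rw [hw, show H y - (H x + s • (H y - H x)) = (s - 1) • (H x - H y) by module, norm_smul,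
        Real.norm_of_nonneg (by linarith)]
    linarith [norm_sub_le_norm_sub_add_norm_sub x y w, hexp x y, hexp y w]
  refine Isometry.of_dist_eq fun x y => ?_
  rw [dist_eq_norm, dist_eq_norm]
  rcases lt_trichotomy ‖x‖ ‖y‖ with h | h | h
  · rw [norm_sub_rev, key y x h, norm_sub_rev]
  · exact hiso x y h
  · exact key x y h

/-- Proposition 3.3: if `T : S_E → S_F` is a surjective isometry with
`‖T x - λ • T y‖ ≥ ‖x - λ • y‖` for all `x, y ∈ S_E`, `λ ≥ 0`, then `T` extends to a
surjective linear isometry `E ≃ F`; in particular its positively homogeneous extension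
`x ↦ ‖x‖ • T (x / ‖x‖)` (with `0 ↦ 0`) is such an extension. -/
theorem stmt_13 {E F : Type*} [NormedAddCommGroup E] [NormedSpace ℝ E] [CompleteSpace E]
    [NormedAddCommGroup F] [NormedSpace ℝ F] [CompleteSpace F]
    (T : E → F)
    (hmap : ∀ x : E, ‖x‖ = 1 → ‖T x‖ = 1)
    (hsurj : ∀ z : F, ‖z‖ = 1 → ∃ x : E, ‖x‖ = 1 ∧ T x = z)
    (hiso : ∀ x y : E, ‖x‖ = 1 → ‖y‖ = 1 → ‖T x - T y‖ = ‖x - y‖)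
    (hgeq : ∀ x y : E, ‖x‖ = 1 → ‖y‖ = 1 → ∀ l : ℝ, 0 ≤ l →
      ‖x - l • y‖ ≤ ‖T x - l • T y‖) :
    ∃ L : E ≃ₗᵢ[ℝ] F, (∀ x : E, ‖x‖ = 1 → L x = T x) ∧
      ∀ x : E, x ≠ 0 → L x = ‖x‖ • T (‖x‖⁻¹ • x) := by
  set H : E → F := fun x => ‖x‖ • T (‖x‖⁻¹ • x) with hH
  have hunit : ∀ x : E, x ≠ 0 → ‖‖x‖⁻¹ • x‖ = 1 := fun x hx => norm_smul_inv_norm (𝕜 := ℝ) hx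
  have hself : ∀ x : E, x ≠ 0 → ‖x‖ • ‖x‖⁻¹ • x = x := fun x hx =>
    smul_inv_smul₀ (norm_ne_zero_iff.2 hx) x
  have H0 : H 0 = 0 := by simp [hH]
  have HT : ∀ x : E, ‖x‖ = 1 → H x = T x := fun x hx => by simp [hH, hx]
  have Hnorm : ∀ x, ‖H x‖ = ‖x‖ := by
    intro x
    rcases eq_or_ne x 0 with rfl | hx
    · simp [H0]
    · simp [hH, norm_smul, hmap _ (hunit x hx)]
  have Hsurj : Function.Surjective H := by
    intro z
    rcases eq_or_ne z 0 with rfl | hz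
    · exact ⟨0, H0⟩
    · obtain ⟨x, hx, hxz⟩ := hsurj (‖z‖⁻¹ • z) (norm_smul_inv_norm (𝕜 := ℝ) hz)
      have hz' := norm_ne_zero_iff.2 hz
      refine ⟨‖z‖ • x, ?_⟩
      simp [hH, norm_smul, hx, smul_smul, hz', hxz]
  have Hexp : ∀ x y, ‖x - y‖ ≤ ‖H x - H y‖ := by
    intro x y
    rcases eq_or_ne x 0 with rfl | hx
    · simp [H0, Hnorm]
    rcases eq_or_ne y 0 with rfl | hy
    · simp [H0, Hnorm]
    have hx' := norm_ne_zero_iff.2 hx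
    have h := hgeq _ _ (hunit x hx) (hunit y hy) (‖y‖ / ‖x‖) (by positivity)
    have hE : x - y = ‖x‖ • (‖x‖⁻¹ • x - (‖y‖ / ‖x‖) • ‖y‖⁻¹ • y) := by
      rw [smul_sub, hself x hx, smul_smul, mul_div_cancel₀ _ hx', hself y hy]
    have hF : H x - H y = ‖x‖ • (T (‖x‖⁻¹ • x) - (‖y‖ / ‖x‖) • T (‖y‖⁻¹ • y)) := by
      rw [smul_sub, smul_smul, mul_div_cancel₀ _ hx']
    rw [hE, hF, norm_smul, norm_smul]
    gcongr
  have Hiso : ∀ x y, ‖x‖ = ‖y‖ → ‖H x - H y‖ = ‖x - y‖ := by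
    intro x y hxy
    rcases eq_or_ne x 0 with rfl | hx
    · simp [H0, Hnorm]
    have hy : y ≠ 0 := by rwa [← norm_ne_zero_iff, ← hxy, norm_ne_zero_iff]
    have h := hiso _ _ (hunit x hx) (hunit y hy)
    simp only [hH]
    rw [← hxy] at h ⊢
    rw [← smul_sub, norm_smul, h, ← smul_sub, norm_smul, norm_inv, norm_norm,
      mul_inv_cancel_left₀ (norm_ne_zero_iff.2 hx)]
  have hisom := isometry_of_expansive_of_isometric_on_spheres Hnorm Hsurj Hexp Hiso
  let e : E ≃ᵢ F := ⟨Equiv.ofBijective H ⟨hisom.injective, Hsurj⟩, hisom⟩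
  exact ⟨e.toRealLinearIsometryEquivOfMapZero H0, HT, fun x _ => rfl⟩
end
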